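/- Let f = (f_1,…,f_s) ⊂ ℝ[x_1,…,x_n] generate a radical ideal and define a smooth equidimensional algebraic set V ⊂ ℂ^n of dimension d. Then there exists a nonempty Zariski open subset 𝒜_f of GL(n,ℂ) such that for every A ∈ 𝒜_f and every 1 ≤ i ≤ d+1, the set crit(φ_i, V^A) is either empty or an algebraic set of dimension i−1 (with the convention crit(φ_{d+1}, V^A) = V^A). -/

import Mathlib

open MvPolynomial

noncomputable section

/-- The common zero locus in `F^σ` of a set of polynomials. -/
def zLocus {σ F : Type*} [CommSemiring F] (S : Set (MvPolynomial σ F)) : Set (σ → F) :=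
  {x | ∀ p ∈ S, eval x p = 0}

/-- The vanishing ideal of a subset of `F^σ`. -/
def vIdeal {σ F : Type*} [CommRing F] (V : Set (σ → F)) : Ideal (MvPolynomial σ F) where
  carrier := {p | ∀ x ∈ V, eval x p = 0}
  add_mem' := by
    intro p q hp hq x hx
    simp [hp x hx, hq x hx]
  zero_mem' := by intro x hx; simp
  smul_mem' := by
    intro c p hp x hx
    simp [smul_eq_mul, hp x hx]

/-- The dimension of an algebraic set, as the Krull dimension of its coordinate ring. -/
def setDim {σ : Type*} (V : Set (σ → ℂ)) : WithBot (WithTop ℕ) :=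
  ringKrullDim (MvPolynomial σ ℂ ⧸ vIdeal V)

/-- An ideal is equidimensional of dimension `d` if every minimal prime over it has
quotient of Krull dimension `d`. -/
def EquidimIdeal {R : Type*} [CommRing R] (I : Ideal R) (d : ℕ) : Prop :=
  ∀ P ∈ I.minimalPrimes, ringKrullDim (R ⧸ P) = (d : WithBot (WithTop ℕ))

/-- Differential at a point `p₀` of the polynomial `g`, applied to the vector `v`. -/
def polyDiff {σ : Type*} [Fintype σ] [DecidableEq σ] (p₀ : σ → ℂ) (g : MvPolynomial σ ℂ)
    (v : σ → ℂ) : ℂ :=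
  ∑ j, v j * eval p₀ (pderiv j g)

/-- The Zariski tangent space of `V` at `p₀`. -/
def tangentAt {σ : Type*} [Fintype σ] [DecidableEq σ] (V : Set (σ → ℂ)) (p₀ : σ → ℂ) :
    Submodule ℂ (σ → ℂ) where
  carrier := {v | ∀ g ∈ vIdeal V, polyDiff p₀ g v = 0}
  add_mem' := by
    intro a b ha hb g hg
    have h1 := ha g hg
    have h2 := hb g hg
    simp only [polyDiff, Pi.add_apply, add_mul, Finset.sum_add_distrib] at *
    simp [h1, h2]
  zero_mem' := by intro g hg; simp [polyDiff]
  smul_mem' := by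
    intro c a ha g hg
    have h1 := ha g hg
    simp only [polyDiff, Pi.smul_apply, smul_eq_mul, mul_assoc, ← Finset.mul_sum] at *
    simp [h1]

/-- The singular locus of `V`, relative to the expected dimension `d`:
points of `V` where the Zariski tangent space does not have dimension `d`. -/
def singLocus {σ : Type*} [Fintype σ] [DecidableEq σ] (V : Set (σ → ℂ)) (d : ℕ) :
    Set (σ → ℂ) :=
  {p | p ∈ V ∧ Module.finrank ℂ (tangentAt V p) ≠ d}

/-- Critical points of the polynomial map with components `φ` restricted to the
nonsingular locus of `V` (`V` of expected dimension `d`). -/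
def critMap {σ : Type*} [Fintype σ] [DecidableEq σ] {ι : Type*}
    (V : Set (σ → ℂ)) (d : ℕ) (φ : ι → MvPolynomial σ ℂ) : Set (σ → ℂ) :=
  {p | p ∈ V ∧ p ∉ singLocus V d ∧
    ¬ Function.Surjective (fun v : tangentAt V p => fun k : ι => polyDiff p (φ k) v)}

/-- The components of the projection on the first `i` coordinates, as polynomials. -/
def projPoly (n i : ℕ) : Fin i → MvPolynomial (Fin n) ℂ :=
  fun k => if h : (k : ℕ) < n then X ⟨k, h⟩ else 0

/-- Critical locus of the projection to the first `i` coordinates restricted to `V`,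
with the convention that for `i = d+1` it is all of `V`. -/
def critProj {n : ℕ} (V : Set (Fin n → ℂ)) (d i : ℕ) : Set (Fin n → ℂ) :=
  if i = d + 1 then V else critMap V d (projPoly n i)

/-- Projection of `ℂ^n` to the first `i` coordinates. -/
def projMap (n i : ℕ) (x : Fin n → ℂ) : Fin i → ℂ :=
  fun k => if h : (k : ℕ) < n then x ⟨k, h⟩ else 0

/-- `φ` restricted to `V` is proper at `β` (Euclidean topology). -/
def ProperAt {n i : ℕ} (φ : (Fin n → ℂ) → Fin i → ℂ) (V : Set (Fin n → ℂ))
    (β : Fin i → ℂ) : Prop :=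
  ∃ O : Set (Fin i → ℂ), IsOpen O ∧ β ∈ O ∧ IsCompact {x | x ∈ V ∧ φ x ∈ closure O}

/-- `φ` restricted to `V` is a proper map (onto its image). -/
def ProperOn {n i : ℕ} (φ : (Fin n → ℂ) → Fin i → ℂ) (V : Set (Fin n → ℂ)) : Prop :=
  ∀ β ∈ φ '' V, ProperAt φ V β

/-- Zariski open subsets of `F^k`: complements of zero loci of sets of polynomials. -/
def IsZariskiOpen {k : ℕ} {F : Type*} [CommSemiring F] (U : Set (Fin k → F)) : Prop :=
  ∃ S : Set (MvPolynomial (Fin k) F), U = {x | ∃ p ∈ S, eval x p ≠ 0}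

/-- Zariski open subsets of the space of `n × n` matrices over `F`. -/
def IsZariskiOpenMat {n : ℕ} {F : Type*} [CommSemiring F]
    (U : Set (Matrix (Fin n) (Fin n) F)) : Prop :=
  ∃ S : Set (MvPolynomial (Fin n × Fin n) F),
    U = {A | ∃ p ∈ S, eval (fun q => A q.1 q.2) p ≠ 0}

/-- Complexification of a rational polynomial. -/
def toC {σ : Type*} (p : MvPolynomial σ ℚ) : MvPolynomial σ ℂ :=
  MvPolynomial.map (algebraMap ℚ ℂ) p

/-- The change of variables `x ↦ A·x` acting on the `x`-variables only
(the `y`-variables are left invariant). -/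
def chgX {n t : ℕ} {F : Type*} [CommRing F] (A : Matrix (Fin n) (Fin n) F)
    (p : MvPolynomial (Fin n ⊕ Fin t) F) : MvPolynomial (Fin n ⊕ Fin t) F :=
  aeval (Sum.elim (fun j => ∑ k, C (A j k) * X (Sum.inl k)) (fun l => X (Sum.inr l))) p

/-- Specialization of the `y`-variables at the point `η`. -/
def specY {n t : ℕ} {F : Type*} [CommRing F] (η : Fin t → F)
    (p : MvPolynomial (Fin n ⊕ Fin t) F) : MvPolynomial (Fin n) F :=
  aeval (Sum.elim X (fun l => C (η l))) p

/-- Jacobian matrix w.r.t. the `x`-variables, evaluated at a point `z ∈ ℂ^{n+t}`. -/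
def jacXAt {n t s : ℕ} (f : Fin s → MvPolynomial (Fin n ⊕ Fin t) ℂ)
    (z : (Fin n ⊕ Fin t) → ℂ) : Matrix (Fin s) (Fin n) ℂ :=
  Matrix.of fun i j => eval z (pderiv (Sum.inl j) (f i))

/-- Symbolic Jacobian matrix of a polynomial system in the variables `x`. -/
def jacPoly {n s : ℕ} {F : Type*} [CommRing F] (g : Fin s → MvPolynomial (Fin n) F) :
    Matrix (Fin s) (Fin n) (MvPolynomial (Fin n) F) :=
  Matrix.of fun i j => pderiv j (g i)

/-- Symbolic Jacobian matrix w.r.t. the `x`-variables of a system in variables `(x,y)`. -/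
def jacPolyX {n t s : ℕ} {F : Type*} [CommRing F]
    (f : Fin s → MvPolynomial (Fin n ⊕ Fin t) F) :
    Matrix (Fin s) (Fin n) (MvPolynomial (Fin n ⊕ Fin t) F) :=
  Matrix.of fun i j => pderiv (Sum.inl j) (f i)

/-- The set of `k`-minors of `M` using only columns of index `≥ i` (0-indexed). -/
def minorsGE {s n : ℕ} {R : Type*} [CommRing R] (M : Matrix (Fin s) (Fin n) R)
    (k i : ℕ) : Set R :=
  {q | ∃ (r : Fin k → Fin s) (c : Fin k → Fin n), Function.Injective r ∧
        Function.Injective c ∧ (∀ l, i ≤ (c l : ℕ)) ∧ q = (M.submatrix r c).det}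

/-- Semi-algebraic formulas over `ℚ[y_1,…,y_t]`: boolean combinations of polynomial
sign conditions. -/
inductive SAForm (t : ℕ) : Type
  | eq (p : MvPolynomial (Fin t) ℚ) : SAForm t
  | pos (p : MvPolynomial (Fin t) ℚ) : SAForm t
  | nonneg (p : MvPolynomial (Fin t) ℚ) : SAForm t
  | ne (p : MvPolynomial (Fin t) ℚ) : SAForm t
  | conj (φ ψ : SAForm t) : SAForm t
  | disj (φ ψ : SAForm t) : SAForm t
  | neg (φ : SAForm t) : SAForm t

/-- Truth value of a semi-algebraic formula at a point of `ℝ^t`. -/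
def SAForm.holds {t : ℕ} : SAForm t → (Fin t → ℝ) → Prop
  | eq p, y => aeval y p = 0
  | pos p, y => 0 < aeval y p
  | nonneg p, y => 0 ≤ aeval y p
  | ne p, y => aeval y p ≠ 0
  | conj φ ψ, y => φ.holds y ∧ ψ.holds y
  | disj φ ψ, y => φ.holds y ∨ ψ.holds y
  | neg φ, y => ¬ φ.holds y

/-- The maximal total degree of the polynomials involved in a semi-algebraic formula. -/
def SAForm.deg {t : ℕ} : SAForm t → ℕ
  | eq p => p.totalDegree
  | pos p => p.totalDegree
  | nonneg p => p.totalDegree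
  | ne p => p.totalDegree
  | conj φ ψ => max φ.deg ψ.deg
  | disj φ ψ => max φ.deg ψ.deg
  | neg φ => φ.deg

/-- The solution set `Z(Φ) ⊆ ℝ^t` of a semi-algebraic formula. -/
def SAForm.zset {t : ℕ} (φ : SAForm t) : Set (Fin t → ℝ) := {y | φ.holds y}

/-- The real points of the variety defined by a rational system in variables `(x, y)`. -/
def realPts {n t s : ℕ} (f : Fin s → MvPolynomial (Fin n ⊕ Fin t) ℚ) :
    Set ((Fin n ⊕ Fin t) → ℝ) :=
  {z | ∀ i, aeval z (f i) = 0}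

/-- The real zero set of a set of rational polynomials. -/
def realZeros {σ : Type*} (S : Set (MvPolynomial σ ℚ)) : Set (σ → ℝ) :=
  {z | ∀ p ∈ S, aeval z p = 0}

/-- The projection `(x, y) ↦ y` on real points. -/
def projY {n t : ℕ} (z : (Fin n ⊕ Fin t) → ℝ) : Fin t → ℝ := z ∘ Sum.inr

/-- The projection `(x, y) ↦ y` on complex points. -/
def projYC {n t : ℕ} (z : (Fin n ⊕ Fin t) → ℂ) : Fin t → ℂ := z ∘ Sum.inr

/-- The complex algebraic set defined by a rational polynomial system. -/
def VC {n t s : ℕ} (f : Fin s → MvPolynomial (Fin n ⊕ Fin t) ℚ) :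
    Set ((Fin n ⊕ Fin t) → ℂ) :=
  zLocus (Set.range fun i => toC (f i))

/-- Assumption A: the ideal generated by `f` is radical, and its algebraic set is
(nonempty) equidimensional of dimension `d + t` with singular locus of dimension `< t`. -/
def AssumpA {n t s : ℕ} (f : Fin s → MvPolynomial (Fin n ⊕ Fin t) ℚ) (d : ℕ) : Prop :=
  (Ideal.span (Set.range f)).IsRadical ∧
  (VC f).Nonempty ∧
  EquidimIdeal (vIdeal (VC f)) (d + t) ∧
  setDim (singLocus (VC f) (d + t)) < (t : WithBot (WithTop ℕ))

/-- Assumption B: the Zariski closure of `π(V)` is all of `ℂ^t` (no nonzero polynomial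
vanishes on `π(V)`), and `π(V ∩ ℝ^{t+n})` has nonzero Lebesgue measure. -/
def AssumpB {n t s : ℕ} (f : Fin s → MvPolynomial (Fin n ⊕ Fin t) ℚ) : Prop :=
  (∀ p : MvPolynomial (Fin t) ℂ, (∀ z ∈ VC f, eval (projYC z) p = 0) → p = 0) ∧
  MeasureTheory.volume (projY '' realPts f) ≠ 0

/-- The conclusion of Lemma (B-param): the system `g` generates a radical
equidimensional ideal whose algebraic set is either empty or smooth of dimension `d`. -/
def GoodSpec {n s : ℕ} (g : Fin s → MvPolynomial (Fin n) ℂ) (d : ℕ) : Prop :=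
  (Ideal.span (Set.range g)).IsRadical ∧
  (zLocus (Set.range g) = ∅ ∨
    (EquidimIdeal (Ideal.span (Set.range g)) d ∧ singLocus (zLocus (Set.range g)) d = ∅))

/-- The field `ℚ(y_1, …, y_t)` of rational fractions. -/
abbrev RatFunc' (t : ℕ) : Type := FractionRing (MvPolynomial (Fin t) ℚ)

/-- View a polynomial of `ℚ[x, y]` as a polynomial of `ℚ(y)[x]`. -/
def toKx {n t : ℕ} (p : MvPolynomial (Fin n ⊕ Fin t) ℚ) :
    MvPolynomial (Fin n) (RatFunc' t) :=
  eval₂ ((C : RatFunc' t →+* MvPolynomial (Fin n) (RatFunc' t)).comp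
      ((algebraMap (MvPolynomial (Fin t) ℚ) (RatFunc' t)).comp (C : ℚ →+* MvPolynomial (Fin t) ℚ)))
    (Sum.elim X (fun l => C (algebraMap (MvPolynomial (Fin t) ℚ) (RatFunc' t) (X l)))) p

/-- Extension of a vector of `Fin d` to a function on `ℕ` (by zero). -/
def extFun {d : ℕ} {F : Type*} [Zero F] (α : Fin d → F) : ℕ → F :=
  fun k => if h : k < d then α ⟨k, h⟩ else 0

/-- The polynomial system `W_i^{A,α}` (over the ground field `F`, the change of
variables being already performed): the input equations, the `(n-d)`-minors of the
truncated Jacobian (except when `i = d+1`), and the equations `x_k = α_k`, `k ≤ i-1`. -/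
def Wsys {n s : ℕ} {F : Type*} [CommRing F] (g : Fin s → MvPolynomial (Fin n) F)
    (d i : ℕ) (a : ℕ → F) : Set (MvPolynomial (Fin n) F) :=
  Set.range g ∪ (if i = d + 1 then ∅ else minorsGE (jacPoly g) (n - d) i) ∪
  {q | ∃ k : Fin n, (k : ℕ) < i - 1 ∧ q = X k - C (a k)}

/-- The polynomial system `W_i^{A,α}` viewed in `ℚ[y][x]` (variables `(x,y)`). -/
def WsysXY {n t s : ℕ} (f : Fin s → MvPolynomial (Fin n ⊕ Fin t) ℚ)
    (d i : ℕ) (a : ℕ → ℚ) : Set (MvPolynomial (Fin n ⊕ Fin t) ℚ) :=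
  Set.range f ∪ (if i = d + 1 then ∅ else minorsGE (jacPolyX f) (n - d) i) ∪
  {q | ∃ k : Fin n, (k : ℕ) < i - 1 ∧ q = X (Sum.inl k) - C (a k)}

/-- A commutative ring is Cohen–Macaulay if, for every maximal ideal `m`, there is a
regular sequence contained in `m` of length the height of `m`. -/
def IsCMRing (R : Type*) [CommRing R] : Prop :=
  ∀ m : Ideal R, ∀ hm : m.IsMaximal, ∃ rs : List R,
    (∀ r ∈ rs, r ∈ m) ∧ RingTheory.Sequence.IsRegular R rs ∧
    (rs.length : WithBot (WithTop ℕ)) = ringKrullDim (@Localization.AtPrime R _ m hm.isPrime)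

/-- Homogenization of a polynomial w.r.t. all its variables, using a fresh variable. -/
def homog {σ : Type*} {F : Type*} [CommSemiring F] [DecidableEq σ] (p : MvPolynomial σ F) :
    MvPolynomial (σ ⊕ Unit) F :=
  p.support.sum fun m =>
    monomial (m.mapDomain Sum.inl +
        Finsupp.single (Sum.inr ()) (p.totalDegree - m.sum fun _ e => e)) (coeff m p)

/-- Zariski open subsets of the space `ℂ[x,y]^s_{≤D}` of `s`-tuples of polynomials of
total degree at most `D`, described by polynomial conditions on the coefficients. -/
def IsZariskiOpenTuple {n t : ℕ} (s D : ℕ)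
    (U : Set (Fin s → MvPolynomial (Fin n ⊕ Fin t) ℂ)) : Prop :=
  ∃ S : Set (MvPolynomial (Fin s × ((Fin n ⊕ Fin t) →₀ ℕ)) ℂ),
    U = {f | (∀ i, (f i).totalDegree ≤ D) ∧
          ∃ p ∈ S, eval (fun im => coeff im.2 (f im.1)) p ≠ 0}

/-- Zariski open subsets of the product of the space of `n×n` complex matrices with `ℂ^n`. -/
def IsZariskiOpenMatVec {n : ℕ}
    (U : Set (Matrix (Fin n) (Fin n) ℂ × (Fin n → ℂ))) : Prop :=
  ∃ S : Set (MvPolynomial ((Fin n × Fin n) ⊕ Fin n) ℂ),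
    U = {Aα | ∃ p ∈ S, eval (Sum.elim (fun q => Aα.1 q.1 q.2) Aα.2) p ≠ 0}


/-- The rows of `M` are linearly dependent modulo the prime `Q`. -/
def DegAt {R : Type*} [CommRing R] {p q : ℕ} (M : Matrix (Fin p) (Fin q) R) (Q : Ideal R) : Prop :=
  ∃ u : Fin p → R, (∃ i, u i ∉ Q) ∧ ∀ j, ∑ i, u i * M i j ∈ Q

/-- One step of fraction-free elimination with pivot `(i0, j0)`. -/
def elimM {R : Type*} [CommRing R] {p q : ℕ} (M : Matrix (Fin (p+1)) (Fin (q+1)) R)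
    (i0 : Fin (p+1)) (j0 : Fin (q+1)) : Matrix (Fin p) (Fin q) R :=
  fun i j => M i0 j0 * M (i0.succAbove i) (j0.succAbove j)
    - M (i0.succAbove i) j0 * M i0 (j0.succAbove j)

lemma degAt_elim_iff {R : Type*} [CommRing R] {p q : ℕ} (M : Matrix (Fin (p+1)) (Fin (q+1)) R)
    (i0 : Fin (p+1)) (j0 : Fin (q+1)) (Q : Ideal R) [hQ : Q.IsPrime] (ha : M i0 j0 ∉ Q) :
    DegAt M Q ↔ DegAt (elimM M i0 j0) Q := by
  constructor
  · rintro ⟨u, ⟨i, hi⟩, hu⟩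
    refine ⟨fun i => u (i0.succAbove i), ?_, ?_⟩
    · by_contra hcon
      push Not at hcon
      have h0 : u i0 * M i0 j0 ∈ Q := by
        have := hu j0
        rw [Fin.sum_univ_succAbove _ i0] at this
        refine (Q.add_mem_iff_left ?_).1 this
        exact Q.sum_mem fun k _ => Q.mul_mem_right _ (hcon k)
      have h1 : u i0 ∈ Q := (hQ.mem_or_mem h0).resolve_right ha
      apply hi
      rcases Fin.eq_self_or_eq_succAbove i0 i with rfl | ⟨k, rfl⟩
      · exact h1
      · exact hcon k
    · intro j
      have e1 := hu (j0.succAbove j)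
      have e2 := hu j0
      rw [Fin.sum_univ_succAbove _ i0] at e1 e2
      have : ∑ i, u (i0.succAbove i) * elimM M i0 j0 i j
          = M i0 j0 * (u i0 * M i0 (j0.succAbove j)
              + ∑ i, u (i0.succAbove i) * M (i0.succAbove i) (j0.succAbove j))
            - M i0 (j0.succAbove j) * (u i0 * M i0 j0
              + ∑ i, u (i0.succAbove i) * M (i0.succAbove i) j0) := by
        simp only [mul_add, Finset.mul_sum]
        rw [add_sub_add_comm, ← Finset.sum_sub_distrib]
        rw [show M i0 j0 * (u i0 * M i0 (j0.succAbove j))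
          - M i0 (j0.succAbove j) * (u i0 * M i0 j0) = 0 by ring, zero_add]
        refine Finset.sum_congr rfl fun k _ => ?_
        simp only [elimM]; ring
      rw [this]
      exact Q.sub_mem (Q.mul_mem_left _ e1) (Q.mul_mem_left _ e2)
  · rintro ⟨u, ⟨i, hi⟩, hu⟩
    refine ⟨Fin.insertNth (α := fun _ => R) i0 (-∑ i, u i * M (i0.succAbove i) j0) (fun i => M i0 j0 * u i), ?_, ?_⟩
    · refine ⟨i0.succAbove i, ?_⟩
      rw [Fin.insertNth_apply_succAbove]
      intro h
      exact (hQ.mem_or_mem h).elim ha hi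
    · intro j
      rw [Fin.sum_univ_succAbove _ i0]
      simp only [Fin.insertNth_apply_same, Fin.insertNth_apply_succAbove]
      rcases Fin.eq_self_or_eq_succAbove j0 j with rfl | ⟨k, rfl⟩
      · have : (-∑ i, u i * M (i0.succAbove i) j) * M i0 j
          + ∑ i, M i0 j * u i * M (i0.succAbove i) j = 0 := by
          rw [neg_mul, Finset.sum_mul, neg_add_eq_sub, ← Finset.sum_sub_distrib]
          exact Finset.sum_eq_zero fun i _ => by ring
        rw [this]; exact Q.zero_mem
      · have : (-∑ i, u i * M (i0.succAbove i) j0) * M i0 (j0.succAbove k)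
          + ∑ i, M i0 j0 * u i * M (i0.succAbove i) (j0.succAbove k)
          = ∑ i, u i * elimM M i0 j0 i k := by
          rw [neg_mul, Finset.sum_mul, neg_add_eq_sub, ← Finset.sum_sub_distrib]
          refine Finset.sum_congr rfl fun i _ => ?_
          simp only [elimM]; ring
        rw [this]; exact hu k

lemma degAt_of_row_mem {R : Type*} [CommRing R] {p q : ℕ} (M : Matrix (Fin p) (Fin q) R)
    (Q : Ideal R) [hQ : Q.IsPrime] (i0 : Fin p) (h : ∀ j, M i0 j ∈ Q) : DegAt M Q := by
  refine ⟨Pi.single i0 1, ⟨i0, ?_⟩, fun j => ?_⟩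
  · simpa using hQ.one_notMem
  · simpa [Pi.single_apply] using h j

lemma DegAt.mono {R : Type*} [CommRing R] {p q : ℕ} {M : Matrix (Fin p) (Fin q) R}
    {Q Q1 : Ideal R} [hQ : Q.IsPrime] [hQ1 : Q1.IsPrime] (hle : Q ≤ Q1) (h : DegAt M Q) :
    DegAt M Q1 := by
  induction p generalizing q with
  | zero => obtain ⟨u, ⟨i, _⟩, _⟩ := h; exact i.elim0
  | succ p ih =>
    by_cases hall : ∀ i j, M i j ∈ Q1
    · exact degAt_of_row_mem M Q1 0 (hall 0)
    · push Not at hall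
      obtain ⟨i0, j0, hij⟩ := hall
      obtain _ | q := q
      · exact j0.elim0
      rw [degAt_elim_iff M i0 j0 Q1 hij]
      rw [degAt_elim_iff M i0 j0 Q (fun h => hij (hle h))] at h
      exact ih h

theorem eagon_northcott {R : Type*} [CommRing R] [IsNoetherianRing R] {p q : ℕ}
    (M : Matrix (Fin p) (Fin q) R) (P : Ideal R) [hP : P.IsPrime] (hpq : p ≤ q + 1)
    (hdeg : DegAt M P) (hmin : ∀ Q : Ideal R, Q.IsPrime → Q < P → ¬ DegAt M Q) :
    P.height + (p : ℕ∞) ≤ (q : ℕ∞) + 1 := by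
  induction p generalizing q R with
  | zero => obtain ⟨u, ⟨i, _⟩, _⟩ := hdeg; exact i.elim0
  | succ p ih =>
    by_cases hall : ∀ i j, M i j ∈ P
    · obtain _ | p := p
      · -- Krull
        have hm : P ∈ (Ideal.span (Set.range (M 0))).minimalPrimes := by
          refine ⟨⟨hP, Ideal.span_le.2 ?_⟩, ?_⟩
          · rintro _ ⟨j, rfl⟩; exact hall 0 j
          · rintro Q ⟨hQ, hQM⟩ hQP
            by_contra hcon
            refine hmin Q hQ (lt_of_le_not_ge hQP hcon) ?_
            exact degAt_of_row_mem M Q 0 fun j => hQM (Ideal.subset_span ⟨j, rfl⟩)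
        have := Ideal.height_le_card_of_mem_minimalPrimes_span (Set.finite_range (M 0)) hm
        have h2 : (Set.range (M 0)).encard ≤ q := by
          rw [← Set.image_univ]
          refine (Set.encard_image_le _ _).trans ?_
          simp
        simp only [zero_add, Nat.cast_one]
        gcongr
        exact this.trans (by simpa using h2)
      · obtain _ | q := q
        · omega
        let PS : Ideal (Polynomial R) := P.map (Polynomial.C : R →+* Polynomial R)
        have hPS : PS.IsPrime := Ideal.isPrime_map_C_of_isPrime
        let M' : Matrix (Fin (p+2)) (Fin (q+1)) (Polynomial R) := fun i j =>
          Polynomial.C (M i j) + if i = 0 ∧ j = 0 then Polynomial.X else 0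
        have hM' : ∀ i j, M' i j = Polynomial.C (M i j) + if i = 0 ∧ j = 0 then Polynomial.X else 0 :=
          fun _ _ => rfl
        have h1 : M' 0 0 ∉ PS := by
          intro h
          rw [hM'] at h; simp only [PS, and_self, if_true] at h
          rw [Ideal.mem_map_C_iff] at h
          have := h 1
          simp [Polynomial.coeff_C] at this
          exact hP.one_notMem this
        have hd : DegAt M' PS := by
          refine degAt_of_row_mem M' PS 1 fun j => ?_
          rw [hM', if_neg (by simp), add_zero]
          exact Ideal.mem_map_of_mem _ (hall _ _)
        have hm : ∀ Q : Ideal (Polynomial R), Q.IsPrime → Q < PS → ¬ DegAt M' Q := by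
          intro Q hQ hlt hdQ
          let N : Ideal (Polynomial R) := P.comap (Polynomial.evalRingHom (0:R))
          have hN : N.IsPrime := Ideal.comap_isPrime _ _
          have hPSN : PS < N := by
            refine lt_of_le_not_ge ?_ ?_
            · refine Ideal.map_le_iff_le_comap.2 fun x hx => ?_
              simpa [N, Ideal.mem_comap] using hx
            · intro h
              have hX : (Polynomial.X : Polynomial R) ∈ N := by simp [N, Ideal.mem_comap]
              have := (Ideal.mem_map_C_iff.1 (h hX)) 1
              simp at this
              exact hP.one_notMem this
          have hNmin : N ∈ (Q ⊔ Ideal.span {(Polynomial.X : Polynomial R)}).minimalPrimes := by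
            refine ⟨⟨hN, sup_le (hlt.le.trans hPSN.le) ?_⟩, ?_⟩
            · rw [Ideal.span_singleton_le_iff_mem]; simp [N, Ideal.mem_comap]
            · rintro Q1 ⟨hQ1, hle1⟩ hQ1N
              have hXQ1 : (Polynomial.X : Polynomial R) ∈ Q1 := hle1 (Ideal.mem_sup_right (Ideal.mem_span_singleton_self _))
              have hQQ1 : Q ≤ Q1 := le_sup_left.trans hle1
              obtain ⟨u, ⟨i, hi⟩, hu⟩ := hdQ.mono hQQ1
              have hred : ∀ f : Polynomial R, f - Polynomial.C (f.eval 0) ∈ Q1 := by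
                intro f
                refine Ideal.mem_of_dvd _ ?_ hXQ1
                rw [Polynomial.X_dvd_iff]; simp [Polynomial.coeff_zero_eq_eval_zero]
              let q1 : Ideal R := Q1.comap (Polynomial.C : R →+* Polynomial R)
              have hq1 : q1.IsPrime := Ideal.comap_isPrime _ _
              have hdeg1 : DegAt M q1 := by
                refine ⟨fun i => (u i).eval 0, ⟨i, fun h => hi ?_⟩, fun j => ?_⟩
                · have := Q1.add_mem (hred (u i)) (show Polynomial.C ((u i).eval 0) ∈ Q1 from h)
                  simpa using this
                · show Polynomial.C _ ∈ Q1
                  have h3 := hred (∑ i, u i * M' i j)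
                  have h4 := (Q1.sub_mem_iff_right (hu j)).1 h3
                  convert h4 using 2
                  rw [Polynomial.eval_finsetSum]
                  refine Finset.sum_congr rfl fun k _ => ?_
                  simp only [hM', Polynomial.eval_mul, Polynomial.eval_add, Polynomial.eval_C]
                  split_ifs <;> simp
              have hq1P : q1 ≤ P := by
                intro x hx
                have := hQ1N (show Polynomial.C x ∈ Q1 from hx)
                simpa [N, Ideal.mem_comap] using this
              have hEq : q1 = P := by
                by_contra hne
                exact hmin q1 hq1 (lt_of_le_of_ne hq1P hne) hdeg1
              intro f hf
              have h5 : f.eval 0 ∈ P := by simpa [N, Ideal.mem_comap] using hf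
              rw [← hEq] at h5
              have := Q1.add_mem (hred f) (show Polynomial.C (f.eval 0) ∈ Q1 from h5)
              simpa using this
          have hk := Ideal.map_height_le_one_of_mem_minimalPrimes hNmin
          have hker : ∀ J : Ideal (Polynomial R), Q ≤ J → RingHom.ker (Ideal.Quotient.mk Q) ≤ J := fun J hJ => by
            rwa [Ideal.mk_ker]
          have hp1 : (PS.map (Ideal.Quotient.mk Q)).IsPrime :=
            Ideal.map_isPrime_of_surjective Ideal.Quotient.mk_surjective (hker _ hlt.le)
          have hp2 : (N.map (Ideal.Quotient.mk Q)).IsPrime :=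
            Ideal.map_isPrime_of_surjective Ideal.Quotient.mk_surjective
              (hker _ (hlt.le.trans hPSN.le))
          have hp0 : (Q.map (Ideal.Quotient.mk Q)).IsPrime :=
            Ideal.map_isPrime_of_surjective Ideal.Quotient.mk_surjective (hker _ le_rfl)
          have hmap : ∀ J K : Ideal (Polynomial R), Q ≤ J → J < K →
              J.map (Ideal.Quotient.mk Q) < K.map (Ideal.Quotient.mk Q) := by
            intro J K hJ hJK
            refine lt_of_le_not_ge (Ideal.map_mono hJK.le) fun hle => hJK.not_ge ?_
            intro x hx
            have := hle (Ideal.mem_map_of_mem _ hx)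
            rwa [Ideal.mem_quotient_iff_mem hJ] at this
          have e1 := Ideal.height_add_one_le_of_lt_of_isPrime (hmap Q PS le_rfl hlt)
          have e2 := Ideal.height_add_one_le_of_lt_of_isPrime (hmap PS N hlt.le hPSN)
          have e3 : (1:ℕ∞) + 1 ≤ 1 := by
            refine le_trans ?_ (e2.trans hk)
            gcongr
            exact le_trans le_add_self e1
          exact absurd e3 (by decide)
        rw [degAt_elim_iff M' 0 0 PS h1] at hd
        have := ih (elimM M' 0 0) PS (by omega) hd (fun Q hQ hlt hdd => by
          refine hm Q hQ hlt ((degAt_elim_iff M' 0 0 Q (fun h => h1 (hlt.le h))).2 hdd))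
        have hht : P.height ≤ PS.height := by
          have : PS.LiesOver P := by
            refine ⟨?_⟩
            ext x
            simp only [Ideal.mem_comap, PS, Ideal.under_def]
            constructor
            · intro hx; exact Ideal.mem_map_of_mem _ hx
            · intro hx
              have := (Ideal.mem_map_C_iff.1 hx) 0
              simpa using this
          rw [Ideal.height_eq_height_add_of_liesOver_of_hasGoingDown P PS]
          exact le_self_add
        push_cast at this ⊢
        calc P.height + ((p : ℕ∞) + 1 + 1) ≤ PS.height + (p + 1 + 1) := by gcongr
          _ = PS.height + (p + 1) + 1 := by ring
          _ ≤ _ := by gcongr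
    · push Not at hall
      obtain ⟨i0, j0, hij⟩ := hall
      obtain _ | q := q
      · exact j0.elim0
      rw [degAt_elim_iff M i0 j0 P hij] at hdeg
      have := ih (elimM M i0 j0) P (by omega) hdeg (fun Q hQ hlt hd => hmin Q hQ hlt
        ((degAt_elim_iff M i0 j0 Q (fun h => hij (hlt.le h))).2 hd))
      push_cast
      rw [← add_assoc]
      gcongr

section DimTheory

/-- Krull dimension is invariant under injective integral extensions. -/
theorem ringKrullDim_eq_of_integral {R S : Type*} [CommRing R] [CommRing S] [Algebra R S]
    [Algebra.IsIntegral R S] [FaithfulSMul R S] : ringKrullDim S = ringKrullDim R := by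
  apply le_antisymm
  · refine Order.krullDim_le_of_strictMono (PrimeSpectrum.comap (algebraMap R S)) ?_
    intro I J h
    exact Ideal.IsIntegral.comap_lt_comap h
  · unfold ringKrullDim Order.krullDim
    refine iSup_le fun l => ?_
    obtain ⟨⟨Q, hQ1, hQ2⟩⟩ := Ideal.nonempty_primesOver (S := S) (l.head.asIdeal)
    obtain ⟨L, hL, -, -⟩ := Ideal.exists_ltSeries_of_hasGoingUp l Q
    rw [← hL]
    exact le_iSup (fun p : LTSeries (PrimeSpectrum S) => (p.length : WithBot ℕ∞)) L

variable {k : Type} [Field k]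

theorem noether_data (A : Type) [CommRing A] [IsDomain A] [Algebra k A] [Algebra.FiniteType k A] :
    ∃ (m : ℕ) (g : MvPolynomial (Fin m) k →ₐ[k] A), Function.Injective g ∧ g.IsIntegral ∧
      ringKrullDim A = m ∧ Algebra.trdeg k A = m := by
  obtain ⟨m, g, hg1, hg2⟩ := exists_integral_inj_algHom_of_fg k A
  refine ⟨m, g, hg1, hg2, ?_, ?_⟩
  · algebraize [g.toRingHom]
    have : FaithfulSMul (MvPolynomial (Fin m) k) A :=
      (faithfulSMul_iff_algebraMap_injective _ _).mpr hg1
    rw [ringKrullDim_eq_of_integral (R := MvPolynomial (Fin m) k),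
      MvPolynomial.ringKrullDim_of_isNoetherianRing]
    simp
  · algebraize [g.toRingHom]
    have : FaithfulSMul (MvPolynomial (Fin m) k) A :=
      (faithfulSMul_iff_algebraMap_injective _ _).mpr hg1
    have hb := (IsTranscendenceBasis.mvPolynomial (Fin m) k)
    have := (hb.algebraMap_comp (A := A)).cardinalMk_eq_trdeg
    simpa using this.symm

/-- Lower bound for heights in polynomial rings. -/
def HtGood (k : Type) [Field k] (B : Type) [CommRing B] [Algebra k B] (m : ℕ) : Prop :=
  ∀ q : Ideal B, q.IsPrime → ∃ h t : ℕ, (h : ℕ∞) ≤ q.height ∧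
    (t : Cardinal) ≤ Algebra.trdeg k (B ⧸ q) ∧ m ≤ h + t

theorem HtGood.poly {B : Type} [CommRing B] [IsNoetherianRing B] [Algebra k B] {m : ℕ}
    (hB : HtGood k B m) : HtGood k (Polynomial B) (m + 1) := by
  intro q hq
  set p : Ideal B := q.comap (algebraMap B (Polynomial B)) with hp
  have hpp : p.IsPrime := Ideal.IsPrime.comap _
  have hlo : q.LiesOver p := ⟨rfl⟩
  obtain ⟨h, t, h1, h2, h3⟩ := hB p hpp
  have hle : p.map Polynomial.C ≤ q := Ideal.map_le_iff_le_comap.mpr le_rfl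
  have hmp : (p.map Polynomial.C).IsPrime := Ideal.isPrime_map_C_of_isPrime
  have hlo' : (p.map Polynomial.C).LiesOver p := by
    constructor
    apply le_antisymm Ideal.le_comap_map
    exact (Ideal.comap_mono hle).trans le_rfl
  have hht : p.height ≤ (p.map Polynomial.C).height := by
    rw [Ideal.height_eq_height_add_of_liesOver_of_hasGoingDown p (p.map Polynomial.C)]
    exact le_self_add
  by_cases hqe : q = p.map Polynomial.C
  · refine ⟨h, t + 1, h1.trans (hht.trans (Ideal.height_mono hle)), ?_, by omega⟩
    let φ : Polynomial B →ₐ[k] Polynomial (B ⧸ p) := Polynomial.mapAlgHom (Ideal.Quotient.mkₐ k p)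
    have hφ : ∀ a ∈ q, φ a = 0 := by
      intro a ha
      have : q ≤ RingHom.ker φ.toRingHom := by
        rw [hqe, Ideal.map_le_iff_le_comap]
        intro x hx
        simp [φ, RingHom.mem_ker, Ideal.Quotient.eq_zero_iff_mem.mpr hx]
      exact this ha
    have hs : Function.Surjective (Ideal.Quotient.liftₐ q φ hφ) := by
      apply Ideal.Quotient.lift_surjective_of_surjective
      exact Polynomial.map_surjective _ Ideal.Quotient.mk_surjective
    have h5 := trdeg_le_of_surjective _ hs
    have h6 := trdeg_add_eq k (B ⧸ p) (A := Polynomial (B ⧸ p))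
    rw [Polynomial.trdeg_of_isDomain] at h6
    refine le_trans ?_ h5
    rw [← h6]
    push_cast
    gcongr
  · refine ⟨h + 1, t, ?_, ?_, by omega⟩
    · have hlt : p.map Polynomial.C < q := lt_of_le_of_ne hle (Ne.symm hqe)
      have := Ideal.height_add_one_le_of_lt_of_isPrime hlt
      push_cast
      exact le_trans (by gcongr; exact h1.trans hht) this
    · refine h2.trans ?_
      refine trdeg_le_of_injective (Ideal.quotientMapₐ q (IsScalarTower.toAlgHom k B (Polynomial B)) ?_) ?_
      · exact le_rfl
      · exact Ideal.quotientMap_injective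

theorem HtGood.equiv {B B' : Type} [CommRing B] [Algebra k B] [CommRing B'] [Algebra k B'] {m : ℕ}
    (e : B ≃ₐ[k] B') (hB : HtGood k B' m) : HtGood k B m := by
  intro q hq
  have hq' : (q.comap (e.symm : B' →ₐ[k] B)).IsPrime := Ideal.IsPrime.comap _
  obtain ⟨h, t, h1, h2, h3⟩ := hB _ hq'
  refine ⟨h, t, ?_, ?_, h3⟩
  · have he : q.comap (e.symm : B' →ₐ[k] B) = q.comap e.symm.toRingEquiv := by ext; rfl
    rw [he] at h1
    rwa [RingEquiv.height_comap] at h1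
  · refine h2.trans ?_
    refine trdeg_le_of_injective
      (Ideal.quotientMapₐ q (e.symm : B' →ₐ[k] B) ?_) ?_
    · exact le_rfl
    · exact Ideal.quotientMap_injective

theorem htGood_mvPolynomial (m : ℕ) : HtGood k (MvPolynomial (Fin m) k) m := by
  induction m with
  | zero => exact fun q hq => ⟨0, 0, by simp, by simp, le_rfl⟩
  | succ m ih => exact HtGood.equiv (finSuccEquiv k m) ih.poly

/-- `dim A ≤ ht Q + dim A/Q`. -/
theorem dim_le_height_add (A : Type) [CommRing A] [IsDomain A] [Algebra k A]
    [Algebra.FiniteType k A] (Q : Ideal A) [Q.IsPrime] {m t h : ℕ}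
    (hm : ringKrullDim A = m) (ht : ringKrullDim (A ⧸ Q) = t) (hh : Q.height ≤ h) : m ≤ h + t := by
  obtain ⟨m', g, hg1, hg2, hg3, hg4⟩ := noether_data (k := k) A
  obtain ⟨t', -, -, -, ht3, ht4⟩ := noether_data (k := k) (A ⧸ Q)
  have e1 : m = m' := by rw [hm] at hg3; exact_mod_cast hg3
  have e2 : t = t' := by rw [ht] at ht3; exact_mod_cast ht3
  subst e1 e2
  algebraize [g.toRingHom]
  have : FaithfulSMul (MvPolynomial (Fin m) k) A :=
    (faithfulSMul_iff_algebraMap_injective _ _).mpr hg1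
  have : IsNoetherianRing A := Algebra.FiniteType.isNoetherianRing k A
  obtain ⟨h', t', a1, a2, a3⟩ := htGood_mvPolynomial (k := k) m
    (Q.comap (algebraMap (MvPolynomial (Fin m) k) A)) (Ideal.IsPrime.comap _)
  have hlo : Q.LiesOver (Q.comap (algebraMap (MvPolynomial (Fin m) k) A)) := ⟨rfl⟩
  have b1 := Ideal.height_eq_height_add_of_liesOver_of_hasGoingDown
    (Q.comap (algebraMap (MvPolynomial (Fin m) k) A)) Q
  have b2 : h' ≤ h := by
    have : (h' : ℕ∞) ≤ h := by
      refine (a1.trans ?_).trans hh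
      rw [b1]; exact le_self_add
    exact_mod_cast this
  have b3 : t' ≤ t := by
    have : (t' : Cardinal) ≤ t := by
      refine a2.trans ?_
      rw [← ht4]
      refine trdeg_le_of_injective
        (Ideal.quotientMapₐ Q g ?_) ?_
      · exact le_rfl
      · exact Ideal.quotientMap_injective
    exact_mod_cast this
  omega

/-- Krull dimension of a quotient is bounded by that of the quotients by primes. -/
theorem ringKrullDim_quot_le {R : Type*} [CommRing R] (I : Ideal R) (b : WithBot ℕ∞)
    (h : ∀ P : Ideal R, P.IsPrime → I ≤ P → ringKrullDim (R ⧸ P) ≤ b) :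
    ringKrullDim (R ⧸ I) ≤ b := by
  unfold ringKrullDim Order.krullDim
  refine iSup_le fun l => ?_
  set P := l.head.asIdeal.comap (Ideal.Quotient.mk I) with hP
  have hPp : P.IsPrime := Ideal.IsPrime.comap _
  have hIP : I ≤ P := by
    intro x hx
    simp [hP, Ideal.mem_comap, Ideal.Quotient.eq_zero_iff_mem.mpr hx]
  refine le_trans ?_ (h P hPp hIP)
  have key : ∀ j, P ≤ (l j).asIdeal.comap (Ideal.Quotient.mk I) := fun j =>
    Ideal.comap_mono (l.monotone (Fin.zero_le _))
  have hker : ∀ j, RingHom.ker (Ideal.Quotient.mk P) ≤ (l j).asIdeal.comap (Ideal.Quotient.mk I) := by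
    intro j; rw [Ideal.mk_ker]; exact key j
  have hcm : ∀ j, (((l j).asIdeal.comap (Ideal.Quotient.mk I)).map (Ideal.Quotient.mk P)).comap
      (Ideal.Quotient.mk P) = (l j).asIdeal.comap (Ideal.Quotient.mk I) := by
    intro j
    rw [Ideal.comap_map_of_surjective' _ Ideal.Quotient.mk_surjective, Ideal.mk_ker]
    exact sup_eq_left.mpr (key j)
  have hpr : ∀ j, (((l j).asIdeal.comap (Ideal.Quotient.mk I)).map
      (Ideal.Quotient.mk P)).IsPrime := fun j =>
    Ideal.map_isPrime_of_surjective Ideal.Quotient.mk_surjective (hker j)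
  let L : LTSeries (PrimeSpectrum (R ⧸ P)) :=
    LTSeries.mk l.length (fun j => ⟨_, hpr j⟩) (by
      intro a b hab
      refine lt_of_le_of_ne (Ideal.map_mono (Ideal.comap_mono (l.monotone hab.le))) ?_
      intro he
      have h1 := congrArg (fun x : PrimeSpectrum (R ⧸ P) =>
        x.asIdeal.comap (Ideal.Quotient.mk P)) he
      simp only [hcm] at h1
      have h2 := Ideal.comap_injective_of_surjective _ Ideal.Quotient.mk_surjective h1
      exact (l.strictMono hab).ne (PrimeSpectrum.ext h2))
  exact le_iSup (fun p : LTSeries (PrimeSpectrum (R ⧸ P)) => (p.length : WithBot ℕ∞)) L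

/-- A dimension bound from algebraic dependence of the coordinates. -/
theorem dim_le_of_dependent {n : ℕ} (P : Ideal (MvPolynomial (Fin n) k)) [P.IsPrime] (i : ℕ)
    (h : ∀ T : Fin (i + 1) → Fin n, ∃ ψ : MvPolynomial (Fin (i + 1)) k, ψ ≠ 0 ∧
      rename T ψ ∈ P) : ringKrullDim (MvPolynomial (Fin n) k ⧸ P) ≤ i := by
  obtain ⟨m, -, -, -, h1, h2⟩ := noether_data (k := k) (MvPolynomial (Fin n) k ⧸ P)
  rw [h1]
  by_contra hlt
  have hlt : i + 1 ≤ m := by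
    by_contra hc
    apply hlt
    exact_mod_cast (by omega : m ≤ i)
  set y : Fin n → MvPolynomial (Fin n) k ⧸ P := fun j => Ideal.Quotient.mk P (X j) with hy
  have hadj : Algebra.adjoin k (Set.range y) = ⊤ := by
    rw [eq_top_iff]
    rintro x -
    obtain ⟨x, rfl⟩ := Ideal.Quotient.mk_surjective x
    have : (Ideal.Quotient.mk P x) = aeval y x := by
      have : (Ideal.Quotient.mkₐ k P) = aeval y := by
        ext j; simp [hy]
      rw [← this]; rfl
    rw [this, Algebra.adjoin_range_eq_range_aeval]
    exact ⟨x, rfl⟩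
  have halg : Algebra.IsAlgebraic (Algebra.adjoin k (Set.range y)) (MvPolynomial (Fin n) k ⧸ P) := by
    refine ⟨fun x => ?_⟩
    exact isAlgebraic_algebraMap (⟨x, by rw [hadj]; trivial⟩ : Algebra.adjoin k (Set.range y))
  obtain ⟨t, ht1, ht2⟩ := exists_isTranscendenceBasis_subset (R := k) (Set.range y)
  have hc := ht2.cardinalMk_eq_trdeg
  rw [h2] at hc
  have hfin : t.Finite := (Set.finite_range y).subset ht1
  have := hfin.fintype
  have hcard : Fintype.card t = m := by
    rw [Cardinal.mk_fintype] at hc; exact_mod_cast hc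
  obtain ⟨e⟩ : Nonempty (Fin (i + 1) ↪ t) := by
    apply Function.Embedding.nonempty_of_card_le
    simpa [hcard] using hlt
  have hT : ∀ j, ∃ l, y l = (e j : MvPolynomial (Fin n) k ⧸ P) := fun j => ht1 (e j).2
  choose T hT using hT
  obtain ⟨ψ, hψ, hψ2⟩ := h T
  have hind := ht2.1.comp e e.injective
  apply hψ
  apply hind
  rw [map_zero]
  have : (aeval (Subtype.val ∘ e) ψ : MvPolynomial (Fin n) k ⧸ P) = Ideal.Quotient.mk P (rename T ψ) := by
    have : (aeval (Subtype.val ∘ e) : _ →ₐ[k] MvPolynomial (Fin n) k ⧸ P) = 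
      (Ideal.Quotient.mkₐ k P).comp (rename T) := by
      ext j
      simp [← hT, hy]
    rw [this]; rfl
  rw [this]
  exact Ideal.Quotient.eq_zero_iff_mem.mpr hψ2

end DimTheory

section Transport

lemma mem_vIdeal {σ F : Type*} [CommRing F] {V : Set (σ → F)} {p : MvPolynomial σ F} :
    p ∈ vIdeal V ↔ ∀ x ∈ V, eval x p = 0 := Iff.rfl

lemma vIdeal_zLocus {n : ℕ} (S : Set (MvPolynomial (Fin n) ℂ)) :
    vIdeal (zLocus S) = (Ideal.span S).radical := by
  rw [← MvPolynomial.vanishingIdeal_zeroLocus_eq_radical (K := ℂ)]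
  ext g
  rw [mem_vIdeal, mem_vanishingIdeal_iff, zeroLocus_span]
  simp [zLocus, coe_aeval_eq_eval]

lemma mem_prime_of_vanish {n : ℕ} (P : Ideal (MvPolynomial (Fin n) ℂ)) [hP : P.IsPrime]
    (g : MvPolynomial (Fin n) ℂ) (h : ∀ x, (∀ q ∈ P, eval x q = 0) → eval x g = 0) : g ∈ P := by
  rw [← MvPolynomial.IsPrime.vanishingIdeal_zeroLocus (K := ℂ) P, mem_vanishingIdeal_iff]
  simpa [coe_aeval_eq_eval] using h

/-- Linear change of variables. -/
def chg {n : ℕ} (A : Matrix (Fin n) (Fin n) ℂ) :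
    MvPolynomial (Fin n) ℂ →ₐ[ℂ] MvPolynomial (Fin n) ℂ :=
  aeval (fun j => ∑ k, C (A j k) * X k)

lemma eval_chg {n : ℕ} (A : Matrix (Fin n) (Fin n) ℂ) (p : Fin n → ℂ)
    (g : MvPolynomial (Fin n) ℂ) : eval p (chg A g) = eval (A.mulVec p) g := by
  have : (aeval p : _ →ₐ[ℂ] ℂ).comp (chg A) = aeval (A.mulVec p) := by
    ext j
    simp [chg, Matrix.mulVec, dotProduct]
  have := DFunLike.congr_fun this g
  simpa [coe_aeval_eq_eval] using this

lemma chg_chg {n : ℕ} {A B : Matrix (Fin n) (Fin n) ℂ} (h : B * A = 1)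
    (g : MvPolynomial (Fin n) ℂ) : chg A (chg B g) = g := by
  apply MvPolynomial.funext
  intro p
  rw [eval_chg, eval_chg, Matrix.mulVec_mulVec, h, Matrix.one_mulVec]

def chgEquiv {n : ℕ} {A B : Matrix (Fin n) (Fin n) ℂ} (h : B * A = 1) (h' : A * B = 1) :
    MvPolynomial (Fin n) ℂ ≃+* MvPolynomial (Fin n) ℂ :=
  { (chg B).toRingHom with
    invFun := chg A
    left_inv := fun g => chg_chg h g
    right_inv := fun g => chg_chg h' g }

lemma vIdeal_image {n : ℕ} (B : Matrix (Fin n) (Fin n) ℂ) (V : Set (Fin n → ℂ)) :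
    vIdeal ((fun v => B.mulVec v) '' V) = (vIdeal V).comap (chg B).toRingHom := by
  ext g
  rw [mem_vIdeal, Ideal.mem_comap, mem_vIdeal]
  simp [eval_chg]

lemma setDim_image {n : ℕ} {A B : Matrix (Fin n) (Fin n) ℂ} (h : B * A = 1) (h' : A * B = 1)
    (V : Set (Fin n → ℂ)) : setDim ((fun v => B.mulVec v) '' V) = setDim V := by
  unfold setDim
  apply ringKrullDim_eq_of_ringEquiv
  refine Ideal.quotientEquiv _ _ (chgEquiv h h') ?_
  have h1 : vIdeal ((fun v => B.mulVec v) '' V) = (vIdeal V).comap (chgEquiv h h') := by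
    rw [vIdeal_image]; rfl
  rw [h1]
  exact (Ideal.map_comap_of_surjective _ (chgEquiv h h').surjective _).symm

lemma image_zLocus {n : ℕ} {A B : Matrix (Fin n) (Fin n) ℂ} (h : B * A = 1) (h' : A * B = 1)
    (S : Set (MvPolynomial (Fin n) ℂ)) :
    (fun v => B.mulVec v) '' zLocus S = zLocus (chg A '' S) := by
  ext x
  constructor
  · rintro ⟨v, hv, rfl⟩ _ ⟨g, hg, rfl⟩
    rw [eval_chg, Matrix.mulVec_mulVec, h', Matrix.one_mulVec]
    exact hv g hg
  · intro hx
    refine ⟨A.mulVec x, fun g hg => ?_, by simp [Matrix.mulVec_mulVec, h]⟩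
    rw [← eval_chg]
    exact hx _ ⟨g, hg, rfl⟩

lemma polyDiff_add {n : ℕ} (p v : Fin n → ℂ) (g h : MvPolynomial (Fin n) ℂ) :
    polyDiff p (g + h) v = polyDiff p g v + polyDiff p h v := by
  simp [polyDiff, mul_add, Finset.sum_add_distrib]

lemma polyDiff_mul {n : ℕ} (p v : Fin n → ℂ) (g h : MvPolynomial (Fin n) ℂ) :
    polyDiff p (g * h) v = eval p g * polyDiff p h v + eval p h * polyDiff p g v := by
  simp only [polyDiff, Derivation.leibniz, smul_eq_mul, map_add, map_mul, Finset.mul_sum,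
    ← Finset.sum_add_distrib]
  refine Finset.sum_congr rfl fun j _ => by ring

lemma polyDiff_C {n : ℕ} (p v : Fin n → ℂ) (a : ℂ) : polyDiff p (C a) v = 0 := by
  simp [polyDiff]

lemma polyDiff_X {n : ℕ} (p v : Fin n → ℂ) (j : Fin n) : polyDiff p (X j) v = v j := by
  simp [polyDiff, pderiv_X, Pi.single_apply, apply_ite]

lemma polyDiff_sum {n : ℕ} {ι : Type*} (p v : Fin n → ℂ) (s : Finset ι)
    (g : ι → MvPolynomial (Fin n) ℂ) :
    polyDiff p (∑ i ∈ s, g i) v = ∑ i ∈ s, polyDiff p (g i) v := by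
  classical
  induction s using Finset.induction_on with
  | empty => simp [polyDiff]
  | insert a s ha ih => rw [Finset.sum_insert ha, Finset.sum_insert ha, polyDiff_add, ih]

lemma polyDiff_chg {n : ℕ} (A : Matrix (Fin n) (Fin n) ℂ) (p v : Fin n → ℂ)
    (g : MvPolynomial (Fin n) ℂ) :
    polyDiff p (chg A g) v = polyDiff (A.mulVec p) g (A.mulVec v) := by
  induction g using MvPolynomial.induction_on with
  | C a => 
    have : chg A (C a) = C a := by simp [chg]
    rw [this, polyDiff_C, polyDiff_C]
  | add g h ih1 ih2 => rw [map_add, polyDiff_add, polyDiff_add, ih1, ih2]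
  | mul_X g j ih =>
    rw [map_mul, polyDiff_mul, polyDiff_mul, ih, polyDiff_X, eval_chg, eval_chg]
    have h1 : chg A (X j) = ∑ k, C (A j k) * X k := by simp [chg]
    have h2 : polyDiff p (chg A (X j)) v = A.mulVec v j := by
      rw [h1, polyDiff_sum]
      simp [polyDiff_mul, polyDiff_X, polyDiff_C, Matrix.mulVec, dotProduct]
    rw [h2]

lemma mem_tangentAt {n : ℕ} (V : Set (Fin n → ℂ)) (p v : Fin n → ℂ) :
    v ∈ tangentAt V p ↔ ∀ g ∈ vIdeal V, polyDiff p g v = 0 := Iff.rfl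

lemma tangentAt_image {n : ℕ} {A B : Matrix (Fin n) (Fin n) ℂ} (_h : B * A = 1) (h' : A * B = 1)
    (V : Set (Fin n → ℂ)) (p v : Fin n → ℂ) :
    B.mulVec v ∈ tangentAt ((fun v => B.mulVec v) '' V) (B.mulVec p) ↔ v ∈ tangentAt V p := by
  rw [mem_tangentAt, mem_tangentAt]
  simp only [vIdeal_image, Ideal.mem_comap]
  constructor
  · intro H g hg
    have := H (chg A g) (by
      show chg B (chg A g) ∈ _
      rwa [chg_chg h'])
    rwa [polyDiff_chg, Matrix.mulVec_mulVec, Matrix.mulVec_mulVec, h', Matrix.one_mulVec,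
      Matrix.one_mulVec] at this
  · intro H g hg
    rw [← polyDiff_chg]
    exact H _ hg

lemma finrank_tangentAt_image {n : ℕ} {A B : Matrix (Fin n) (Fin n) ℂ} (h : B * A = 1)
    (h' : A * B = 1) (V : Set (Fin n → ℂ)) (p : Fin n → ℂ) :
    Module.finrank ℂ (tangentAt ((fun v => B.mulVec v) '' V) (B.mulVec p)) =
      Module.finrank ℂ (tangentAt V p) := by
  have hinj : Function.Injective (Matrix.mulVecLin B) := by
    intro x y hxy
    have := congrArg A.mulVec hxy
    simpa [Matrix.mulVecLin_apply, Matrix.mulVec_mulVec, h'] using this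
  have hh : (tangentAt V p).map (Matrix.mulVecLin B) =
        tangentAt ((fun v => B.mulVec v) '' V) (B.mulVec p) := by
    ext v
    rw [Submodule.mem_map]
    constructor
    · rintro ⟨w, hw, rfl⟩
      rw [Matrix.mulVecLin_apply]
      exact (tangentAt_image h h' V p w).mpr hw
    · intro hv
      have hv' : B.mulVec (A.mulVec v) = v := by
        rw [Matrix.mulVec_mulVec, h, Matrix.one_mulVec]
      refine ⟨A.mulVec v, ?_, hv'⟩
      rw [← tangentAt_image h h', hv']
      exact hv
  rw [← hh]
  exact (LinearEquiv.finrank_eq (Submodule.equivMapOfInjective _ hinj _)).symm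

/-- rows of gradients at a point -/
def gradAt {n s : ℕ} (F : Fin s → MvPolynomial (Fin n) ℂ) (p : Fin n → ℂ) (l : Fin s) :
    Fin n → ℂ := fun j => eval p (pderiv j (F l))

/-- Critical points for the linear projection with rows `b`. -/
def WtSet {n s i : ℕ} (F : Fin s → MvPolynomial (Fin n) ℂ) (b : Fin i → Fin n → ℂ) :
    Set (Fin n → ℂ) :=
  {p | p ∈ zLocus (Set.range F) ∧ ∃ μ : Fin i → ℂ, μ ≠ 0 ∧
    ∑ k, μ k • b k ∈ Submodule.span ℂ (Set.range (gradAt F p))}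

lemma mem_tangentAt_iff {n s : ℕ} (F : Fin s → MvPolynomial (Fin n) ℂ)
    (hrad : (Ideal.span (Set.range F)).IsRadical) (p v : Fin n → ℂ)
    (hp : p ∈ zLocus (Set.range F)) :
    v ∈ tangentAt (zLocus (Set.range F)) p ↔ ∀ l, v ⬝ᵥ gradAt F p l = 0 := by
  rw [mem_tangentAt, vIdeal_zLocus, hrad.radical]
  constructor
  · intro H l
    exact H (F l) (Ideal.subset_span ⟨l, rfl⟩)
  · intro H g hg
    have hv : ∀ g ∈ Ideal.span (Set.range F), eval p g = 0 ∧ polyDiff p g v = 0 := by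
      intro g hg
      induction hg using Submodule.span_induction with
      | mem x hx =>
        obtain ⟨l, rfl⟩ := hx
        exact ⟨hp _ ⟨l, rfl⟩, H l⟩
      | zero => simp [polyDiff]
      | add x y _ _ hx hy => rw [map_add, polyDiff_add]; simp [hx, hy]
      | smul a x _ hx => rw [smul_eq_mul, map_mul, polyDiff_mul]; simp [hx]
    exact (hv g hg).2

/-- duality: a functional vanishing on the common kernel is in the span. -/
lemma mem_span_of_dual {n : ℕ} {ι : Type*} [Finite ι] (w : ι → Fin n → ℂ) (u : Fin n → ℂ) :
    u ∈ Submodule.span ℂ (Set.range w) ↔ ∀ v : Fin n → ℂ, (∀ l, v ⬝ᵥ w l = 0) → v ⬝ᵥ u = 0 := by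
  constructor
  · intro hu v hv
    induction hu using Submodule.span_induction with
    | mem x hx => obtain ⟨l, rfl⟩ := hx; exact hv l
    | zero => simp
    | add x y _ _ hx hy => simp [hx, hy]
    | smul a x _ hx => simp [hx]
  · intro H
    have e := dotProductEquiv ℂ (Fin n)
    have h1 := mem_span_of_iInf_ker_le_ker (L := fun l => dotProductEquiv ℂ (Fin n) (w l))
      (K := dotProductEquiv ℂ (Fin n) u) (by
        intro v hv
        simp only [Submodule.mem_iInf, LinearMap.mem_ker, dotProductEquiv_apply_apply] at hv ⊢
        rw [dotProduct_comm]
        exact H v fun l => by rw [dotProduct_comm]; exact hv l)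
    rw [show (Set.range fun l => dotProductEquiv ℂ (Fin n) (w l)) =
      (dotProductEquiv ℂ (Fin n)).toLinearMap '' (Set.range w) by
        rw [← Set.range_comp]; rfl, Submodule.span_image] at h1
    obtain ⟨x, hx, hxu⟩ := h1
    have : x = u := (dotProductEquiv ℂ (Fin n)).injective hxu
    exact this ▸ hx

lemma not_surj_iff {n i : ℕ} (T : Submodule ℂ (Fin n → ℂ)) (b : Fin i → Fin n → ℂ) :
    (¬ Function.Surjective (fun v : T => fun k : Fin i => (v : Fin n → ℂ) ⬝ᵥ b k)) ↔
      ∃ μ : Fin i → ℂ, μ ≠ 0 ∧ ∀ v ∈ T, v ⬝ᵥ (∑ k, μ k • b k) = 0 := by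
  let L : T →ₗ[ℂ] (Fin i → ℂ) :=
    { toFun := fun v k => (v : Fin n → ℂ) ⬝ᵥ b k
      map_add' := by intro x y; ext k; simp
      map_smul' := by intro c x; ext k; simp }
  have hL : ∀ (μ : Fin i → ℂ) (v : T), μ ⬝ᵥ L v = (v : Fin n → ℂ) ⬝ᵥ (∑ k, μ k • b k) := by
    intro μ v
    rw [dotProduct_sum]
    simp [dotProduct, L, Finset.mul_sum, mul_left_comm]
  constructor
  · intro h
    have hlt : LinearMap.range L < ⊤ := by
      rw [lt_top_iff_ne_top]
      intro he
      exact h (LinearMap.range_eq_top.mp he)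
    obtain ⟨f, hf, hf2⟩ := Submodule.exists_le_ker_of_lt_top _ hlt
    obtain ⟨μ, rfl⟩ := (dotProductEquiv ℂ (Fin i)).surjective f
    refine ⟨μ, by rintro rfl; exact hf (map_zero _), fun v hv => ?_⟩
    have := hf2 (LinearMap.mem_range_self L ⟨v, hv⟩)
    rw [LinearMap.mem_ker, dotProductEquiv_apply_apply, hL] at this
    exact this
  · rintro ⟨μ, hμ, H⟩ hs
    apply hμ
    ext k
    obtain ⟨v, hv⟩ := hs (Pi.single k 1)
    have h1 := hL μ v
    rw [H v v.2, show L v = Pi.single k 1 from hv] at h1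
    simpa using h1

theorem critMap_image {n s d i : ℕ} {A B : Matrix (Fin n) (Fin n) ℂ} (h : B * A = 1)
    (h' : A * B = 1) (F : Fin s → MvPolynomial (Fin n) ℂ)
    (hrad : (Ideal.span (Set.range F)).IsRadical) (hin : i ≤ n)
    (hsm : singLocus (zLocus (Set.range F)) d = ∅) :
    critMap ((fun v => B.mulVec v) '' zLocus (Set.range F)) d (projPoly n i) =
      (fun v => B.mulVec v) '' WtSet F (fun (k : Fin i) => B (Fin.castLE hin k)) := by
  have hpp : ∀ k, projPoly n i k = X (Fin.castLE hin k) := by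
    intro k
    have : (k : ℕ) < n := by omega
    simp [projPoly, this]
    rfl
  have key : ∀ p, p ∈ zLocus (Set.range F) → 
      ((¬ Function.Surjective (fun v : tangentAt ((fun v => B.mulVec v) '' zLocus (Set.range F))
          (B.mulVec p) => fun k : Fin i => polyDiff (B.mulVec p) (projPoly n i k) v)) ↔
        ∃ μ : Fin i → ℂ, μ ≠ 0 ∧ ∑ k, μ k • B (Fin.castLE hin k) ∈
          Submodule.span ℂ (Set.range (gradAt F p))) := by
    intro p hp
    simp only [mem_span_of_dual, ← mem_tangentAt_iff F hrad p _ hp]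
    rw [← not_surj_iff (tangentAt (zLocus (Set.range F)) p) (fun k => B (Fin.castLE hin k))]
    simp only [hpp, polyDiff_X]
    apply not_congr
    constructor
    · intro H y
      obtain ⟨v, hv⟩ := H y
      have hv' : B.mulVec (A.mulVec (v : Fin n → ℂ)) = v := by
        rw [Matrix.mulVec_mulVec, h, Matrix.one_mulVec]
      refine ⟨⟨A.mulVec v, ?_⟩, ?_⟩
      · rw [← tangentAt_image h h', hv']; exact v.2
      · rw [← hv]
        ext k
        simp only
        conv_rhs => rw [← hv']
        rw [dotProduct_comm]; rfl
    · intro H y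
      obtain ⟨v, hv⟩ := H y
      refine ⟨⟨B.mulVec v, (tangentAt_image h h' _ _ _).mpr v.2⟩, ?_⟩
      rw [← hv]
      ext k
      simp only
      rw [dotProduct_comm]; rfl
  have hsing : ∀ p ∈ zLocus (Set.range F),
      B.mulVec p ∉ singLocus ((fun v => B.mulVec v) '' zLocus (Set.range F)) d := by
    rintro p hp ⟨-, hne⟩
    have hns : p ∉ singLocus (zLocus (Set.range F)) d := by rw [hsm]; simp
    apply hns
    refine ⟨hp, ?_⟩
    rwa [finrank_tangentAt_image h h'] at hne
  ext x
  constructor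
  · rintro ⟨⟨p, hp, rfl⟩, -, h2⟩
    exact ⟨p, ⟨hp, (key p hp).mp h2⟩, rfl⟩
  · rintro ⟨p, ⟨hp, h2⟩, rfl⟩
    exact ⟨⟨p, hp, rfl⟩, hsing p hp, (key p hp).mpr h2⟩

end Transport

section Points

lemma exists_local_rows {n s d : ℕ} (F : Fin s → MvPolynomial (Fin n) ℂ)
    (hrad : (Ideal.span (Set.range F)).IsRadical)
    (hsm : singLocus (zLocus (Set.range F)) d = ∅) (p : Fin n → ℂ)
    (hp : p ∈ zLocus (Set.range F)) :
    d ≤ n ∧ Module.finrank ℂ (Submodule.span ℂ (Set.range (gradAt F p))) = n - d ∧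
    ∃ r : Fin (n - d) → Fin s, LinearIndependent ℂ (fun a => gradAt F p (r a)) := by
  have hd : Module.finrank ℂ (tangentAt (zLocus (Set.range F)) p) = d := by
    by_contra hne
    have : p ∈ singLocus (zLocus (Set.range F)) d := ⟨hp, hne⟩
    rw [hsm] at this
    exact this
  let G : Matrix (Fin s) (Fin n) ℂ := Matrix.of (gradAt F p)
  have hT : tangentAt (zLocus (Set.range F)) p = LinearMap.ker G.mulVecLin := by
    ext v
    rw [mem_tangentAt_iff F hrad p v hp, LinearMap.mem_ker, Matrix.mulVecLin_apply, funext_iff]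
    refine forall_congr' fun l => ?_
    rw [dotProduct_comm]; rfl
  have h1 := LinearMap.finrank_range_add_finrank_ker G.mulVecLin
  rw [← hT, hd] at h1
  have h2 : G.rank = Module.finrank ℂ (Submodule.span ℂ (Set.range (gradAt F p))) :=
    Matrix.rank_eq_finrank_span_row G
  rw [Matrix.rank] at h2
  rw [h2] at h1
  simp only [Module.finrank_fintype_fun_eq_card, Fintype.card_fin] at h1
  have h3 : Module.finrank ℂ (Submodule.span ℂ (Set.range (gradAt F p))) = n - d := by omega
  refine ⟨by omega, h3, ?_⟩
  obtain ⟨f, hf1, hf2, hf3⟩ := Submodule.exists_fun_fin_finrank_span_eq ℂ (Set.range (gradAt F p))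
  choose r hr using hf1
  refine ⟨fun a => r (Fin.cast h3.symm a), ?_⟩
  simp only [hr]
  exact hf3.comp _ (Fin.cast_injective _)

lemma span_local_rows {n s d : ℕ} (F : Fin s → MvPolynomial (Fin n) ℂ)
    (hrad : (Ideal.span (Set.range F)).IsRadical)
    (hsm : singLocus (zLocus (Set.range F)) d = ∅) (p : Fin n → ℂ)
    (hp : p ∈ zLocus (Set.range F)) (r : Fin (n - d) → Fin s)
    (hr : LinearIndependent ℂ (fun a => gradAt F p (r a))) :
    Submodule.span ℂ (Set.range (fun a => gradAt F p (r a))) =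
      Submodule.span ℂ (Set.range (gradAt F p)) := by
  obtain ⟨-, h3, -⟩ := exists_local_rows F hrad hsm p hp
  apply Submodule.eq_of_le_of_finrank_eq
  · apply Submodule.span_mono
    rintro _ ⟨a, rfl⟩
    exact ⟨r a, rfl⟩
  · rw [h3, finrank_span_eq_card hr]; simp

/-- the row-degeneracy of a polynomial matrix at a point -/
def PtDeg {n p q : ℕ} (M : Matrix (Fin p) (Fin q) (MvPolynomial (Fin n) ℂ)) (x : Fin n → ℂ) : Prop :=
  ∃ u : Fin p → ℂ, u ≠ 0 ∧ ∀ j, ∑ i, u i * eval x (M i j) = 0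

lemma not_ptDeg_iff {n p q : ℕ} (M : Matrix (Fin p) (Fin q) (MvPolynomial (Fin n) ℂ))
    (x : Fin n → ℂ) : ¬ PtDeg M x ↔ LinearIndependent ℂ (fun i j => eval x (M i j)) := by
  rw [Fintype.linearIndependent_iff]
  unfold PtDeg
  push Not
  constructor
  · intro h g hg i
    by_contra hi
    obtain ⟨j, hj⟩ := h g (fun h0 => hi (by simp [h0]))
    apply hj
    have := congrFun hg j
    simpa using this
  · intro h u hu
    by_contra hc
    push Not at hc
    apply hu
    ext i
    refine h u ?_ i
    ext j
    simpa using hc j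

/-- a polynomial detecting row-degeneracy near a nondegenerate point -/
lemma exists_det_poly {n p q : ℕ} (M : Matrix (Fin p) (Fin q) (MvPolynomial (Fin n) ℂ))
    (x : Fin n → ℂ) (hx : ¬ PtDeg M x) :
    ∃ h : MvPolynomial (Fin n) ℂ, eval x h ≠ 0 ∧ ∀ y, PtDeg M y → eval y h = 0 := by
  rw [not_ptDeg_iff] at hx
  let N : Matrix (Fin p) (Fin q) ℂ := M.map (eval x)
  have hN : LinearIndependent ℂ N.row := hx
  obtain ⟨K, hK⟩ : ∃ K : Matrix (Fin q) (Fin p) ℂ, N * K = 1 :=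
    by
    rw [← Matrix.mulVec_surjective_iff_exists_right_inverse]
    have h1 : N.rank = Fintype.card (Fin p) := LinearIndependent.rank_matrix hN
    have h2 : LinearMap.range N.mulVecLin = ⊤ := by
      apply Submodule.eq_top_of_finrank_eq
      rw [← Matrix.rank, h1]; simp
    exact LinearMap.range_eq_top.mp h2
  let MK : Matrix (Fin p) (Fin p) (MvPolynomial (Fin n) ℂ) :=
    fun i j => ∑ k, M i k * C (K k j)
  refine ⟨MK.det, ?_, ?_⟩
  · rw [RingHom.map_det]
    have : (eval x).mapMatrix MK = N * K := by
      ext i j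
      change eval x (∑ k, M i k * C (K k j)) = _
      simp [Matrix.mul_apply, N]
    rw [this, hK]; simp
  · rintro y ⟨u, hu, hu2⟩
    rw [RingHom.map_det]
    have h1 : (eval y).mapMatrix MK = M.map (eval y) * K := by
      ext i j
      change eval y (∑ k, M i k * C (K k j)) = _
      simp [Matrix.mul_apply]
    rw [h1]
    apply Matrix.exists_vecMul_eq_zero_iff.mp
    refine ⟨u, hu, ?_⟩
    rw [← Matrix.vecMul_vecMul]
    have : Matrix.vecMul u (M.map (eval y)) = 0 := by
      ext j; simpa [Matrix.vecMul, dotProduct] using hu2 j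
    rw [this, Matrix.zero_vecMul]

/-- gradients of the chosen equations, as polynomial rows -/
def gradM {n s m : ℕ} (F : Fin s → MvPolynomial (Fin n) ℂ) (r : Fin m → Fin s) :
    Matrix (Fin m) (Fin n) (MvPolynomial (Fin n) ℂ) := fun a j => pderiv j (F (r a))

/-- gradients together with constant rows -/
def bigM {n s m i : ℕ} (F : Fin s → MvPolynomial (Fin n) ℂ) (r : Fin m → Fin s)
    (b : Fin i → Fin n → ℂ) :
    Matrix (Fin (m + i)) (Fin n) (MvPolynomial (Fin n) ℂ) :=
  Fin.append (gradM F r) (fun k j => C (b k j))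

lemma bigM_castAdd {n s m i : ℕ} (F : Fin s → MvPolynomial (Fin n) ℂ) (r : Fin m → Fin s)
    (b : Fin i → Fin n → ℂ) (a : Fin m) (j : Fin n) :
    bigM F r b (Fin.castAdd i a) j = pderiv j (F (r a)) := by
  have h : bigM F r b (Fin.castAdd i a) = gradM F r a := Fin.append_left _ _ a
  rw [h]; rfl

lemma bigM_natAdd {n s m i : ℕ} (F : Fin s → MvPolynomial (Fin n) ℂ) (r : Fin m → Fin s)
    (b : Fin i → Fin n → ℂ) (k : Fin i) (j : Fin n) :
    bigM F r b (Fin.natAdd m k) j = C (b k j) := by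
  have h : bigM F r b (Fin.natAdd m k) = fun j => C (b k j) :=
    Fin.append_right (gradM F r) (fun k j => C (b k j)) k
  rw [h]

lemma ptDeg_bigM_iff {n s m i : ℕ} (F : Fin s → MvPolynomial (Fin n) ℂ) (r : Fin m → Fin s)
    (b : Fin i → Fin n → ℂ) (p : Fin n → ℂ) :
    PtDeg (bigM F r b) p ↔ ∃ (ν : Fin m → ℂ) (μ : Fin i → ℂ), (ν ≠ 0 ∨ μ ≠ 0) ∧
      ∑ a, ν a • gradAt F p (r a) + ∑ k, μ k • b k = 0 := by
  have key : ∀ u : Fin (m + i) → ℂ, (∀ j, ∑ a, u a * eval p (bigM F r b a j) = 0) ↔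
      ∑ a, u (Fin.castAdd i a) • gradAt F p (r a) + ∑ k, u (Fin.natAdd m k) • b k = 0 := by
    intro u
    rw [funext_iff]
    refine forall_congr' fun j => ?_
    rw [Fin.sum_univ_add]
    simp [bigM_castAdd, bigM_natAdd, gradAt]
  constructor
  · rintro ⟨u, hu, h⟩
    refine ⟨_, _, ?_, (key u).mp h⟩
    by_contra hc
    push Not at hc
    apply hu
    ext a
    refine Fin.addCases (fun a => ?_) (fun k => ?_) a
    · exact congrFun hc.1 a
    · exact congrFun hc.2 k
  · rintro ⟨ν, μ, h0, h⟩
    refine ⟨Fin.append ν μ, ?_, (key _).mpr (by simpa using h)⟩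
    intro hz
    rcases h0 with h0 | h0
    · apply h0; ext a
      simpa using congrFun hz (Fin.castAdd i a)
    · apply h0; ext a
      simpa using congrFun hz (Fin.natAdd m a)

lemma wt_ptDeg {n s d i : ℕ} (F : Fin s → MvPolynomial (Fin n) ℂ)
    (hrad : (Ideal.span (Set.range F)).IsRadical)
    (hsm : singLocus (zLocus (Set.range F)) d = ∅) (b : Fin i → Fin n → ℂ)
    (r : Fin (n - d) → Fin s) (p : Fin n → ℂ) (hp : p ∈ WtSet F b) : PtDeg (bigM F r b) p := by
  obtain ⟨hp1, μ, hμ, h⟩ := hp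
  rw [ptDeg_bigM_iff]
  by_cases hr : LinearIndependent ℂ (fun a => gradAt F p (r a))
  · rw [← span_local_rows F hrad hsm p hp1 r hr, Submodule.mem_span_range_iff_exists_fun] at h
    obtain ⟨c, hc⟩ := h
    refine ⟨-c, μ, Or.inr hμ, ?_⟩
    simp [hc]
  · rw [Fintype.not_linearIndependent_iff] at hr
    obtain ⟨g, hg, a, ha⟩ := hr
    refine ⟨g, 0, Or.inl (fun h0 => ha (by simp [h0])), by simp [hg]⟩

lemma ptDeg_wt {n s m i : ℕ} (F : Fin s → MvPolynomial (Fin n) ℂ) (b : Fin i → Fin n → ℂ)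
    (r : Fin m → Fin s) (p : Fin n → ℂ) (hp : p ∈ zLocus (Set.range F))
    (hr : LinearIndependent ℂ (fun a => gradAt F p (r a)))
    (hd : PtDeg (bigM F r b) p) : p ∈ WtSet F b := by
  rw [ptDeg_bigM_iff] at hd
  obtain ⟨ν, μ, h0, h⟩ := hd
  refine ⟨hp, μ, ?_, ?_⟩
  · rintro rfl
    rcases h0 with h0 | h0
    · apply h0
      ext a
      exact Fintype.linearIndependent_iff.mp hr ν (by simpa using h) a
    · exact h0 rfl
  · rw [← neg_mem_iff, ← eq_neg_of_add_eq_zero_left h]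
    exact Submodule.sum_mem _ fun a _ => Submodule.smul_mem _ _ (Submodule.subset_span ⟨r a, rfl⟩)

theorem wt_algebraic {n s d i : ℕ} (F : Fin s → MvPolynomial (Fin n) ℂ)
    (hrad : (Ideal.span (Set.range F)).IsRadical)
    (hsm : singLocus (zLocus (Set.range F)) d = ∅) (b : Fin i → Fin n → ℂ) :
    WtSet F b = zLocus (vIdeal (WtSet F b) : Set (MvPolynomial (Fin n) ℂ)) := by
  apply Set.Subset.antisymm
  · intro p hp g hg
    exact hg p hp
  · intro p hp
    have hpV : p ∈ zLocus (Set.range F) := by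
      intro g hg
      exact hp g (fun x hx => hx.1 g hg)
    by_contra hW
    obtain ⟨-, -, r, hr⟩ := exists_local_rows F hrad hsm p hpV
    have hnd : ¬ PtDeg (bigM F r b) p := fun hd => hW (ptDeg_wt F b r p hpV hr hd)
    obtain ⟨h, h1, h2⟩ := exists_det_poly _ p hnd
    exact h1 (hp h fun x hx => h2 x (wt_ptDeg F hrad hsm b r x hx))

end Points

section Lower

lemma degAt_ker_of_ptDeg {n p q : ℕ} (M : Matrix (Fin p) (Fin q) (MvPolynomial (Fin n) ℂ))
    (x : Fin n → ℂ) (h : PtDeg M x) : DegAt M (RingHom.ker (eval x)) := by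
  obtain ⟨u, hu, h⟩ := h
  obtain ⟨i, hi⟩ := Function.ne_iff.mp hu
  refine ⟨fun i => C (u i), ⟨i, ?_⟩, fun j => ?_⟩
  · simpa [RingHom.mem_ker] using hi
  · rw [RingHom.mem_ker]; simpa using h j

lemma ptDeg_of_degAt_ker {n p q : ℕ} (M : Matrix (Fin p) (Fin q) (MvPolynomial (Fin n) ℂ))
    (x : Fin n → ℂ) (h : DegAt M (RingHom.ker (eval x))) : PtDeg M x := by
  obtain ⟨u, ⟨i, hi⟩, h⟩ := h
  refine ⟨fun i => eval x (u i), ?_, fun j => ?_⟩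
  · intro h0
    exact hi (congrFun h0 i)
  · have := h j
    rw [RingHom.mem_ker] at this
    simpa using this

lemma degAt_comap {R S : Type*} [CommRing R] [CommRing S] (φ : R →+* S)
    (hφ : Function.Surjective φ) {p q : ℕ} (M : Matrix (Fin p) (Fin q) R) (Q : Ideal S) :
    DegAt (M.map φ) Q ↔ DegAt M (Q.comap φ) := by
  constructor
  · rintro ⟨u, ⟨i, hi⟩, h⟩
    choose v hv using fun i => hφ (u i)
    refine ⟨v, ⟨i, by rwa [Ideal.mem_comap, hv]⟩, fun j => ?_⟩
    rw [Ideal.mem_comap]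
    simpa [hv] using h j
  · rintro ⟨u, ⟨i, hi⟩, h⟩
    refine ⟨fun i => φ (u i), ⟨i, hi⟩, fun j => ?_⟩
    have := h j
    rw [Ideal.mem_comap] at this
    simpa using this

/-- existence of a large prime of degeneracy inside the ideal of a point -/
theorem exists_deg_prime {n d p q : ℕ} (q0 : Ideal (MvPolynomial (Fin n) ℂ)) [hq0 : q0.IsPrime]
    (hdim : ringKrullDim (MvPolynomial (Fin n) ℂ ⧸ q0) = (d : WithBot ℕ∞))
    (M : Matrix (Fin p) (Fin q) (MvPolynomial (Fin n) ℂ)) (hpq : p ≤ q + 1)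
    (x : Fin n → ℂ) (hx : ∀ g ∈ q0, eval x g = 0) (hM : PtDeg M x) :
    ∃ Q : Ideal (MvPolynomial (Fin n) ℂ), Q.IsPrime ∧ q0 ≤ Q ∧ (∀ g ∈ Q, eval x g = 0) ∧
      DegAt M Q ∧ ∃ t : ℕ, ringKrullDim (MvPolynomial (Fin n) ℂ ⧸ Q) = (t : WithBot ℕ∞) ∧
        d + p ≤ q + 1 + t := by
  let A0 := MvPolynomial (Fin n) ℂ ⧸ q0
  let φ : MvPolynomial (Fin n) ℂ →+* A0 := Ideal.Quotient.mk q0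
  have hφ : Function.Surjective φ := Ideal.Quotient.mk_surjective
  let e : A0 →+* ℂ := Ideal.Quotient.lift q0 (eval x) hx
  have he : (RingHom.ker e).comap φ = RingHom.ker (eval x) := by
    ext g
    exact Iff.rfl
  have h1 : DegAt (M.map φ) (RingHom.ker e) := by
    rw [degAt_comap φ hφ, he]
    exact degAt_ker_of_ptDeg M x hM
  let 𝒮 : Set (PrimeSpectrum A0) := {Q | DegAt (M.map φ) Q.asIdeal ∧ Q.asIdeal ≤ RingHom.ker e}
  have hwf : WellFounded ((· < ·) : PrimeSpectrum A0 → PrimeSpectrum A0 → Prop) :=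
    Subrelation.wf (r := InvImage (· < ·) (fun Q : PrimeSpectrum A0 => Q.asIdeal.height))
      (fun {a b} hab => by
        have ha := a.isPrime
        have hb := b.isPrime
        have hab' : a.asIdeal < b.asIdeal := hab
        have : b.asIdeal.FiniteHeight := ⟨Or.inr (Ideal.height_ne_top hb.ne_top)⟩
        exact Ideal.height_strict_mono_of_isPrime_of_isPrime hab')
      (InvImage.wf _ wellFounded_lt)
  obtain ⟨Q, ⟨hQ1, hQ2⟩, hQmin⟩ := hwf.has_min 𝒮 ⟨⟨RingHom.ker e, RingHom.ker_isPrime e⟩, h1, le_rfl⟩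
  have hQp := Q.isPrime
  have hen := eagon_northcott (M.map φ) Q.asIdeal hpq hQ1 (by
    intro Q' hQ' hlt hdeg
    exact hQmin ⟨Q', hQ'⟩ ⟨hdeg, hlt.le.trans hQ2⟩ hlt)
  obtain ⟨t, -, -, -, ht, -⟩ := noether_data (k := ℂ) (A0 ⧸ Q.asIdeal)
  have hfin : Q.asIdeal.height ≠ ⊤ := Ideal.height_ne_top hQp.ne_top
  obtain ⟨h, hh⟩ := ENat.ne_top_iff_exists.mp hfin
  have h3 := dim_le_height_add (k := ℂ) A0 Q.asIdeal hdim ht hh.ge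
  rw [← hh] at hen
  have h4 : h + p ≤ q + 1 := by exact_mod_cast hen
  refine ⟨Q.asIdeal.comap φ, inferInstance, ?_, ?_, (degAt_comap φ hφ M _).mp hQ1, t, ?_, by omega⟩
  · intro g hg
    rw [Ideal.mem_comap, Ideal.Quotient.eq_zero_iff_mem.mpr hg]
    exact zero_mem _
  · intro g hg
    have : g ∈ (RingHom.ker e).comap φ := hQ2 hg
    rwa [he] at this
  · rw [← ht]
    have hsurj : Function.Surjective ((Ideal.Quotient.mk Q.asIdeal).comp φ) :=
      Ideal.Quotient.mk_surjective.comp hφ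
    have hk : RingHom.ker ((Ideal.Quotient.mk Q.asIdeal).comp φ) = Q.asIdeal.comap φ := by
      rw [← RingHom.comap_ker, Ideal.mk_ker]
    rw [← hk]
    exact ringKrullDim_eq_of_ringEquiv (RingHom.quotientKerEquivOfSurjective hsurj)

theorem wt_lower {n s d i : ℕ} (F : Fin s → MvPolynomial (Fin n) ℂ)
    (hrad : (Ideal.span (Set.range F)).IsRadical)
    (hequi : EquidimIdeal (vIdeal (zLocus (Set.range F))) d)
    (hsm : singLocus (zLocus (Set.range F)) d = ∅) (b : Fin i → Fin n → ℂ)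
    (hi : 1 ≤ i) (hid : i ≤ d) (hW : (WtSet F b).Nonempty) :
    ((i - 1 : ℕ) : WithBot (WithTop ℕ)) ≤ setDim (WtSet F b) := by
  obtain ⟨p, hp⟩ := hW
  obtain ⟨hdn, -, r, hr⟩ := exists_local_rows F hrad hsm p hp.1
  have hle : vIdeal (zLocus (Set.range F)) ≤ RingHom.ker (eval p) := by
    intro g hg
    exact hg p hp.1
  have hkp : (RingHom.ker (eval p)).IsPrime := RingHom.ker_isPrime _
  obtain ⟨q0, hq0, hq0le⟩ := Ideal.exists_minimalPrimes_le hle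
  have hq0p : q0.IsPrime := hq0.1.1
  obtain ⟨Q, hQ, hq0Q, hQx, hdeg, t, ht, hdt⟩ := exists_deg_prime q0 (hequi q0 hq0) (bigM F r b)
    (by omega) p (fun g hg => hq0le hg) (wt_ptDeg F hrad hsm b r p hp)
  have hgp : ¬ PtDeg (gradM F r) p := by
    rw [not_ptDeg_iff]; exact hr
  obtain ⟨h, h1, h2⟩ := exists_det_poly (gradM F r) p hgp
  have hIQ : vIdeal (WtSet F b) ≤ Q := by
    intro g hg
    have hmem : g * h ∈ Q := by
      apply mem_prime_of_vanish
      intro y hy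
      rw [map_mul]
      by_cases hyd : PtDeg (gradM F r) y
      · rw [h2 y hyd, mul_zero]
      · have hyV : y ∈ zLocus (Set.range F) := by
          intro f hf
          apply hy
          apply hq0Q
          apply hq0.1.2
          intro z hz
          exact hz f hf
        have : y ∈ WtSet F b := by
          refine ptDeg_wt F b r y hyV ((not_ptDeg_iff _ _).mp hyd) ?_
          apply ptDeg_of_degAt_ker
          have : (RingHom.ker (eval y)).IsPrime := RingHom.ker_isPrime _
          exact hdeg.mono (fun f hf => hy f hf)
        rw [hg y this, zero_mul]
    rcases hQ.mem_or_mem hmem with h' | h'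
    · exact h'
    · exact absurd (hQx h h') h1
  have hle2 : ringKrullDim (MvPolynomial (Fin n) ℂ ⧸ Q) ≤ setDim (WtSet F b) :=
    ringKrullDim_le_of_surjective (Ideal.Quotient.factor hIQ) (Ideal.Quotient.factor_surjective hIQ)
  rw [ht] at hle2
  refine le_trans ?_ hle2
  have : i - 1 ≤ t := by omega
  exact WithBot.coe_le_coe.mpr (WithTop.coe_le_coe.mpr this)

end Lower

section Upper

lemma exists_aeval_eq_zero {D0 σ τ : Type} [CommRing D0] [IsDomain D0] [Algebra ℂ D0]
    [Fintype σ] [Fintype τ] [FaithfulSMul ℂ D0] {d : ℕ} (hd : Algebra.trdeg ℂ D0 = d)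
    (hc : d + Fintype.card τ < Fintype.card σ) (gen : σ → MvPolynomial τ D0) :
    ∃ Φ : MvPolynomial σ ℂ, Φ ≠ 0 ∧ ∀ (e : D0 →ₐ[ℂ] ℂ) (pt : τ → ℂ),
      eval (fun t => eval₂ (e : D0 →+* ℂ) pt (gen t)) Φ = 0 := by
  let Ψ : MvPolynomial σ ℂ →ₐ[ℂ] MvPolynomial τ D0 := aeval gen
  have hninj : ¬ Function.Injective Ψ := by
    intro hinj
    have h1 := trdeg_le_of_injective Ψ hinj
    have h2 := trdeg_add_eq ℂ D0 (A := MvPolynomial τ D0)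
    rw [hd, MvPolynomial.trdeg_of_isDomain] at h2
    rw [← h2, MvPolynomial.trdeg_of_isDomain] at h1
    simp only [Cardinal.mk_fintype, Cardinal.lift_natCast] at h1
    have h3 : Fintype.card σ ≤ d + Fintype.card τ := by exact_mod_cast h1
    omega
  rw [injective_iff_map_eq_zero] at hninj
  push Not at hninj
  obtain ⟨Φ, hΦ, hΦ0⟩ := hninj
  refine ⟨Φ, hΦ0, fun e pt => ?_⟩
  have hcomp : ((eval₂Hom (e : D0 →+* ℂ) pt).comp Ψ.toRingHom) =
      eval (fun t => eval₂ (e : D0 →+* ℂ) pt (gen t)) := by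
    apply MvPolynomial.ringHom_ext
    · intro c
      have h1 : Ψ (C c) = C (algebraMap ℂ D0 c) := by
        change Ψ (algebraMap ℂ _ c) = _
        rw [AlgHom.commutes]
        rfl
      change eval₂ (e : D0 →+* ℂ) pt (Ψ (C c)) = _
      rw [h1]
      simp
    · intro q
      change eval₂ (e : D0 →+* ℂ) pt (Ψ (X q)) = _
      have h1 : Ψ (X q) = gen q := aeval_X _ _
      rw [h1, eval_X]
  rw [← hcomp]
  change (eval₂Hom (e : D0 →+* ℂ) pt) (Ψ Φ) = 0
  rw [hΦ, map_zero]

lemma card_ne_row {n : ℕ} (j : Fin n) :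
    Fintype.card {q : Fin n × Fin n // q.1 ≠ j} + n = n * n := by
  have e1 := Fintype.card_subtype_compl (fun q : Fin n × Fin n => q.1 = j)
  have e2 : Fintype.card {q : Fin n × Fin n // q.1 = j} = n := by
    have : {q : Fin n × Fin n // q.1 = j} ≃ Fin n :=
      { toFun := fun q => q.1.2
        invFun := fun l => ⟨(j, l), rfl⟩
        left_inv := by rintro ⟨⟨a, b⟩, h⟩; simp at h; simp [h]
        right_inv := fun l => rfl }
    rw [Fintype.card_congr this, Fintype.card_fin]
  rw [e2] at e1
  have e3 : Fintype.card {q : Fin n × Fin n // q.1 ≠ j} = n * n - n := by simpa using e1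
  have : n ≤ n * n := Nat.le_mul_self n
  omega

lemma exists_dependence {n s d i : ℕ} (F : Fin s → MvPolynomial (Fin n) ℂ) (hin : i ≤ n)
    (hdn : d ≤ n) (P : Ideal (MvPolynomial (Fin n) ℂ)) [hP : P.IsPrime]
    (hdim : ringKrullDim (MvPolynomial (Fin n) ℂ ⧸ P) = (d : WithBot ℕ∞))
    (j : Fin i) (r : Fin (n - d) → Fin s) (T : Fin i → Fin n) :
    ∃ Φ : MvPolynomial (Fin i ⊕ (Fin n × Fin n)) ℂ, Φ ≠ 0 ∧
      ∀ p : Fin n → ℂ, (∀ g ∈ P, eval p g = 0) → ∀ B : Matrix (Fin n) (Fin n) ℂ,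
        ∀ (μ : {k : Fin i // k ≠ j} → ℂ) (ν : Fin (n - d) → ℂ),
        (∀ l, B (Fin.castLE hin j) l =
          ∑ k, μ k * B (Fin.castLE hin k.1) l + ∑ a, ν a * gradAt F p (r a) l) →
        eval (Sum.elim (fun a => p (T a)) (fun q => B q.1 q.2)) Φ = 0 := by
  obtain ⟨m, -, -, -, hm1, hm2⟩ := noether_data (k := ℂ) (MvPolynomial (Fin n) ℂ ⧸ P)
  have hmd : m = d := by
    have : ((m : ℕ∞) : WithBot ℕ∞) = ((d : ℕ∞) : WithBot ℕ∞) := hm1.symm.trans hdim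
    exact_mod_cast this
  subst hmd
  have hne : ∀ k : {k : Fin i // k ≠ j}, Fin.castLE hin k.1 ≠ Fin.castLE hin j := by
    intro k h
    exact k.2 (Fin.castLE_injective hin h)
  have hc2 : Fintype.card {k : Fin i // k ≠ j} + 1 = i := by
    have := j.pos
    simp
    omega
  have hc1 := card_ne_row (Fin.castLE hin j)
  obtain ⟨Φ, hΦ0, hΦ⟩ := exists_aeval_eq_zero (σ := Fin i ⊕ (Fin n × Fin n))
    (τ := {q : Fin n × Fin n // q.1 ≠ Fin.castLE hin j} ⊕ ({k : Fin i // k ≠ j} ⊕ Fin (n - m)))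
    hm2 (by
      simp only [Fintype.card_sum, Fintype.card_prod, Fintype.card_fin] at *
      omega) (Sum.elim
    (fun a => C (Ideal.Quotient.mk P (X (T a))))
    (fun q => if h : q.1 ≠ Fin.castLE hin j then X (Sum.inl ⟨q, h⟩) else
      ∑ k : {k : Fin i // k ≠ j}, X (Sum.inr (Sum.inl k)) *
        X (Sum.inl ⟨(Fin.castLE hin k.1, q.2), hne k⟩) +
      ∑ a : Fin (n - m), X (Sum.inr (Sum.inr a)) *
        C (Ideal.Quotient.mk P (pderiv q.2 (F (r a))))))
  refine ⟨Φ, hΦ0, ?_⟩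
  intro p hp B μ ν hB
  obtain ⟨e, he⟩ : ∃ e : (MvPolynomial (Fin n) ℂ ⧸ P) →ₐ[ℂ] ℂ,
      ∀ g, e (Ideal.Quotient.mk P g) = eval p g := by
    refine ⟨Ideal.Quotient.liftₐ P (aeval p) (fun g hg => by
      have h0 := hp g hg
      rwa [← coe_aeval_eq_eval] at h0), fun g => ?_⟩
    have h0 : aeval p g = eval p g := congrArg (fun t : _ →+* ℂ => t g) (coe_aeval_eq_eval p)
    rw [← h0]
    rfl
  have h := hΦ e
    (Sum.elim (fun q => B q.1.1 q.1.2) (Sum.elim μ ν))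
  convert h using 3
  ext q
  rcases q with a | ⟨k, l⟩
  · simp [he]
  · by_cases h : k = Fin.castLE hin j
    · subst h
      simp [hB, gradAt, eval₂_add, eval₂_sum, eval₂_mul, he]
    · simp [h]

lemma exists_dependence_all {n s d i : ℕ} (F : Fin s → MvPolynomial (Fin n) ℂ) (hin : i ≤ n)
    (hdn : d ≤ n)
    (hrad : (Ideal.span (Set.range F)).IsRadical)
    (hequi : EquidimIdeal (vIdeal (zLocus (Set.range F))) d)
    (hsm : singLocus (zLocus (Set.range F)) d = ∅)
    (T : Fin i → Fin n) :
    ∃ Φ : MvPolynomial (Fin i ⊕ (Fin n × Fin n)) ℂ, Φ ≠ 0 ∧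
      ∀ (B : Matrix (Fin n) (Fin n) ℂ), ∀ p ∈ WtSet F (fun k : Fin i => B (Fin.castLE hin k)),
        eval (Sum.elim (fun a => p (T a)) (fun q => B q.1 q.2)) Φ = 0 := by
  have hfin : (vIdeal (zLocus (Set.range F))).minimalPrimes.Finite :=
    Ideal.finite_minimalPrimes_of_isNoetherianRing _ _
  have : Fintype (vIdeal (zLocus (Set.range F))).minimalPrimes := hfin.fintype
  have key : ∀ w : (vIdeal (zLocus (Set.range F))).minimalPrimes × Fin i × (Fin (n - d) → Fin s),
      ∃ Φ : MvPolynomial (Fin i ⊕ (Fin n × Fin n)) ℂ, Φ ≠ 0 ∧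
      ∀ p : Fin n → ℂ, (∀ g ∈ w.1.1, eval p g = 0) → ∀ B : Matrix (Fin n) (Fin n) ℂ,
        ∀ (μ : {k : Fin i // k ≠ w.2.1} → ℂ) (ν : Fin (n - d) → ℂ),
        (∀ l, B (Fin.castLE hin w.2.1) l =
          ∑ k, μ k * B (Fin.castLE hin k.1) l + ∑ a, ν a * gradAt F p (w.2.2 a) l) →
        eval (Sum.elim (fun a => p (T a)) (fun q => B q.1 q.2)) Φ = 0 := by
    rintro ⟨⟨P, hP⟩, j, r⟩
    have := hP.1.1
    exact exists_dependence F hin hdn P (hequi P hP) j r T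
  choose Φ hΦ0 hΦ using key
  refine ⟨∏ w, Φ w, Finset.prod_ne_zero_iff.mpr fun w _ => hΦ0 w, ?_⟩
  intro B p hp
  obtain ⟨hpV, μ, hμ, hspan⟩ := hp
  obtain ⟨-, -, r, hr⟩ := exists_local_rows F hrad hsm p hpV
  have hle : vIdeal (zLocus (Set.range F)) ≤ RingHom.ker (eval p) := by
    intro g hg
    exact hg p hpV
  have hkp : (RingHom.ker (eval p)).IsPrime := RingHom.ker_isPrime _
  obtain ⟨P, hP, hPle⟩ := Ideal.exists_minimalPrimes_le hle
  rw [← span_local_rows F hrad hsm p hpV r hr, Submodule.mem_span_range_iff_exists_fun] at hspan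
  obtain ⟨c, hc⟩ := hspan
  obtain ⟨j, hj⟩ := Function.ne_iff.mp hμ
  rw [map_prod]
  apply Finset.prod_eq_zero (Finset.mem_univ ((⟨P, hP⟩, j, r) : _ × Fin i × (Fin (n - d) → Fin s)))
  refine hΦ (⟨P, hP⟩, j, r) p (fun g hg => hPle hg) B (fun k => -(μ j)⁻¹ * μ k.1)
    (fun a => (μ j)⁻¹ * c a) ?_
  intro l
  have hcl := congrFun hc l
  simp only [Finset.sum_apply, Pi.smul_apply, smul_eq_mul] at hcl
  have hsplit := Fintype.sum_eq_add_sum_subtype_ne (fun k => μ k * B (Fin.castLE hin k) l) j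
  rw [hsplit] at hcl
  change B (Fin.castLE hin j) l = ∑ k : {k : Fin i // k ≠ j}, -(μ j)⁻¹ * μ k.1 * B (Fin.castLE hin k.1) l
    + ∑ a, (μ j)⁻¹ * c a * gradAt F p (r a) l
  simp only [mul_assoc, ← Finset.mul_sum]
  rw [hcl]
  have hj' : μ j ≠ 0 := hj
  field_simp
  ring

theorem wt_upper {n s d i : ℕ} (F : Fin s → MvPolynomial (Fin n) ℂ) (hin : i + 1 ≤ n)
    (hdn : d ≤ n)
    (hrad : (Ideal.span (Set.range F)).IsRadical)
    (hequi : EquidimIdeal (vIdeal (zLocus (Set.range F))) d)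
    (hsm : singLocus (zLocus (Set.range F)) d = ∅) :
    ∃ c : MvPolynomial (Fin n × Fin n) ℂ, c ≠ 0 ∧
      ∀ (B : Matrix (Fin n) (Fin n) ℂ), eval (fun q => B q.1 q.2) c ≠ 0 →
        setDim (WtSet F (fun k : Fin (i + 1) => B (Fin.castLE hin k))) ≤
          ((i : ℕ) : WithBot (WithTop ℕ)) := by
  choose Φ hΦ0 hΦ using fun T : Fin (i + 1) → Fin n =>
    exists_dependence_all F hin hdn hrad hequi hsm T
  have hpt : ∀ T, ∃ z, eval z (Φ T) ≠ 0 := by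
    intro T
    by_contra hc
    push Not at hc
    exact hΦ0 T (MvPolynomial.funext fun z => by simpa using hc z)
  choose z hz using hpt
  let c : (Fin (i + 1) → Fin n) → MvPolynomial (Fin n × Fin n) ℂ := fun T =>
    aeval (Sum.elim (fun a => C (z T (Sum.inl a))) X) (Φ T)
  have hce : ∀ T (B : Fin n × Fin n → ℂ), eval B (c T) =
      eval (Sum.elim (fun a => z T (Sum.inl a)) B) (Φ T) := by
    intro T B
    change ((eval B).comp (aeval (Sum.elim (fun a => C (z T (Sum.inl a))) X)).toRingHom) (Φ T) = _
    congr 1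
    apply MvPolynomial.ringHom_ext
    · intro t; simp
    · rintro (a | q) <;> simp
  refine ⟨∏ T, c T, Finset.prod_ne_zero_iff.mpr fun T _ h0 => ?_, ?_⟩
  · apply hz T
    have := hce T (fun q => z T (Sum.inr q))
    rw [h0, map_zero] at this
    rw [this]
    congr 2
    ext (a | q) <;> rfl
  intro B hB
  rw [map_prod, Finset.prod_ne_zero_iff] at hB
  unfold setDim
  apply ringKrullDim_quot_le
  intro P hP hle
  apply dim_le_of_dependent
  intro T
  have hBT := hB T (Finset.mem_univ _)
  rw [hce] at hBT
  let ψ : MvPolynomial (Fin (i + 1)) ℂ := aeval (Sum.elim X (fun q => C (B q.1 q.2))) (Φ T)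
  have hψ : ∀ y : Fin (i + 1) → ℂ, eval y ψ = eval (Sum.elim y (fun q => B q.1 q.2)) (Φ T) := by
    intro y
    change ((eval y).comp (aeval (Sum.elim X (fun q : Fin n × Fin n => C (B q.1 q.2)))).toRingHom) (Φ T) = _
    congr 1
    apply MvPolynomial.ringHom_ext
    · intro t; simp
    · rintro (a | q) <;> simp
  refine ⟨ψ, ?_, hle ?_⟩
  · intro h0
    apply hBT
    rw [← hψ, h0, map_zero]
  · intro p hp
    rw [eval_rename, hψ]
    exact hΦ T B p hp

end Upper

section Final

lemma eval_detX {n : ℕ} (A : Matrix (Fin n) (Fin n) ℂ) :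
    eval (fun q : Fin n × Fin n => A q.1 q.2) (Matrix.mvPolynomialX (Fin n) (Fin n) ℂ).det = A.det := by
  rw [RingHom.map_det]
  congr 1
  ext i j
  simp

lemma eval_adjX {n : ℕ} (A : Matrix (Fin n) (Fin n) ℂ) (i j : Fin n) :
    eval (fun q : Fin n × Fin n => A q.1 q.2)
      ((Matrix.mvPolynomialX (Fin n) (Fin n) ℂ).adjugate i j) = A.adjugate i j := by
  have h := RingHom.map_adjugate (eval (fun q : Fin n × Fin n => A q.1 q.2))
    (Matrix.mvPolynomialX (Fin n) (Fin n) ℂ)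
  have h2 : (eval (fun q : Fin n × Fin n => A q.1 q.2)).mapMatrix
      (Matrix.mvPolynomialX (Fin n) (Fin n) ℂ) = A := by
    ext i j; simp
  rw [h2] at h
  exact congrFun (congrFun h i) j

lemma exists_inv_poly {n : ℕ} (c : MvPolynomial (Fin n × Fin n) ℂ) :
    ∃ (N : ℕ) (q : MvPolynomial (Fin n × Fin n) ℂ), ∀ A : Matrix (Fin n) (Fin n) ℂ,
      IsUnit A.det → eval (fun t => A t.1 t.2) q = A.det ^ N * eval (fun t => A⁻¹ t.1 t.2) c := by
  induction c using MvPolynomial.induction_on with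
  | C a => exact ⟨0, C a, fun A _ => by simp⟩
  | add p1 p2 h1 h2 =>
    obtain ⟨N1, q1, h1⟩ := h1
    obtain ⟨N2, q2, h2⟩ := h2
    refine ⟨N1 + N2, q1 * (Matrix.mvPolynomialX (Fin n) (Fin n) ℂ).det ^ N2 +
      q2 * (Matrix.mvPolynomialX (Fin n) (Fin n) ℂ).det ^ N1, fun A hA => ?_⟩
    rw [map_add, map_mul, map_mul, map_pow, map_pow, eval_detX, h1 A hA, h2 A hA, map_add]
    ring
  | mul_X p1 t h1 =>
    obtain ⟨N1, q1, h1⟩ := h1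
    refine ⟨N1 + 1, q1 * (Matrix.mvPolynomialX (Fin n) (Fin n) ℂ).adjugate t.1 t.2, fun A hA => ?_⟩
    rw [map_mul, map_mul, eval_adjX, h1 A hA, eval_X]
    have h0 : A.det ≠ 0 := hA.ne_zero
    have : A⁻¹ t.1 t.2 = (A.det)⁻¹ * A.adjugate t.1 t.2 := by
      rw [Matrix.inv_def, Ring.inverse_eq_inv']; rfl
    rw [this]
    field_simp
    ring

lemma setDim_equidim {n d : ℕ} (V : Set (Fin n → ℂ)) (hne : V.Nonempty)
    (hequi : EquidimIdeal (vIdeal V) d) : setDim V = (d : WithBot (WithTop ℕ)) := by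
  apply le_antisymm
  · apply ringKrullDim_quot_le
    intro P hP hle
    obtain ⟨q0, hq0, hq0le⟩ := Ideal.exists_minimalPrimes_le hle
    rw [← hequi q0 hq0]
    exact ringKrullDim_le_of_surjective (Ideal.Quotient.factor hq0le)
      (Ideal.Quotient.factor_surjective hq0le)
  · obtain ⟨p, hp⟩ := hne
    have hle : vIdeal V ≤ RingHom.ker (eval p) := by
      intro g hg
      exact hg p hp
    have hkp : (RingHom.ker (eval p)).IsPrime := RingHom.ker_isPrime _
    obtain ⟨q0, hq0, -⟩ := Ideal.exists_minimalPrimes_le hle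
    rw [← hequi q0 hq0]
    exact ringKrullDim_le_of_surjective (Ideal.Quotient.factor hq0.1.2)
      (Ideal.Quotient.factor_surjective hq0.1.2)

theorem main_complex (n s d : ℕ) (F : Fin s → MvPolynomial (Fin n) ℂ)
    (hrad : (Ideal.span (Set.range F)).IsRadical)
    (hne : (zLocus (Set.range F)).Nonempty)
    (hequi : EquidimIdeal (vIdeal (zLocus (Set.range F))) d)
    (hsm : singLocus (zLocus (Set.range F)) d = ∅) :
    ∃ 𝒜 : Set (Matrix (Fin n) (Fin n) ℂ),
      IsZariskiOpenMat 𝒜 ∧ 𝒜.Nonempty ∧ (∀ A ∈ 𝒜, IsUnit A.det) ∧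
      ∀ A ∈ 𝒜, ∀ i : ℕ, 1 ≤ i → i ≤ d + 1 →
        ∀ W : Set (Fin n → ℂ),
          W = critProj ((fun v => A⁻¹.mulVec v) '' (zLocus (Set.range F))) d i →
          W = ∅ ∨ ((∃ S : Set (MvPolynomial (Fin n) ℂ), W = zLocus S) ∧
            setDim W = ((i - 1 : ℕ) : WithBot (WithTop ℕ))) := by
  have hdn : d ≤ n := by
    obtain ⟨p, hp⟩ := hne
    exact (exists_local_rows F hrad hsm p hp).1
  choose c hc0 hc using fun i : Fin d =>
    wt_upper (i := i) F (by omega : (i : ℕ) + 1 ≤ n) hdn hrad hequi hsm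
  obtain ⟨N, q, hq⟩ := exists_inv_poly (∏ i, c i)
  let Δ : MvPolynomial (Fin n × Fin n) ℂ := (Matrix.mvPolynomialX (Fin n) (Fin n) ℂ).det
  have hmem : ∀ A : Matrix (Fin n) (Fin n) ℂ, eval (fun t => A t.1 t.2) (Δ * q) ≠ 0 ↔
      IsUnit A.det ∧ ∀ i, eval (fun t => A⁻¹ t.1 t.2) (c i) ≠ 0 := by
    intro A
    rw [map_mul, eval_detX]
    constructor
    · intro h
      have hA : IsUnit A.det := isUnit_iff_ne_zero.mpr (left_ne_zero_of_mul h)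
      refine ⟨hA, ?_⟩
      rw [hq A hA] at h
      have := right_ne_zero_of_mul (right_ne_zero_of_mul h)
      rw [map_prod, Finset.prod_ne_zero_iff] at this
      exact fun i => this i (Finset.mem_univ _)
    · rintro ⟨hA, h⟩
      rw [hq A hA, map_prod]
      exact mul_ne_zero hA.ne_zero (mul_ne_zero (pow_ne_zero _ hA.ne_zero)
        (Finset.prod_ne_zero_iff.mpr fun i _ => h i))
  refine ⟨{A | eval (fun t => A t.1 t.2) (Δ * q) ≠ 0}, ⟨{Δ * q}, by simp⟩, ?_,
    fun A hA => ((hmem A).mp hA).1, ?_⟩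
  · have hne0 : Δ * ∏ i, c i ≠ 0 :=
      mul_ne_zero (Matrix.det_mvPolynomialX_ne_zero _ _) (Finset.prod_ne_zero_iff.mpr fun i _ => hc0 i)
    obtain ⟨z, hz⟩ : ∃ z, eval z (Δ * ∏ i, c i) ≠ 0 := by
      by_contra hcon
      push Not at hcon
      exact hne0 (MvPolynomial.funext fun z => by simpa using hcon z)
    let B : Matrix (Fin n) (Fin n) ℂ := fun i j => z (i, j)
    have hzB : z = fun t => B t.1 t.2 := rfl
    rw [hzB, map_mul, eval_detX, map_prod] at hz
    have hB : IsUnit B.det := isUnit_iff_ne_zero.mpr (left_ne_zero_of_mul hz)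
    refine ⟨B⁻¹, (hmem _).mpr ⟨?_, ?_⟩⟩
    · exact (Matrix.isUnit_nonsing_inv_det_iff).mpr hB
    · rw [Matrix.nonsing_inv_nonsing_inv B hB]
      have := Finset.prod_ne_zero_iff.mp (right_ne_zero_of_mul hz)
      exact fun i => this i (Finset.mem_univ _)
  · intro A hA i hi hid W hW
    obtain ⟨hAu, hAc⟩ := (hmem A).mp hA
    have h1 : A⁻¹ * A = 1 := Matrix.nonsing_inv_mul A hAu
    have h2 : A * A⁻¹ = 1 := Matrix.mul_nonsing_inv A hAu
    by_cases hid1 : i = d + 1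
    · right
      subst hid1
      rw [critProj, if_pos rfl] at hW
      subst hW
      refine ⟨⟨_, image_zLocus h1 h2 _⟩, ?_⟩
      rw [setDim_image h1 h2, setDim_equidim _ hne hequi]
      rfl
    · obtain ⟨i, rfl⟩ : ∃ i', i = i' + 1 := ⟨i - 1, by omega⟩
      have hin : i + 1 ≤ n := by omega
      rw [critProj, if_neg hid1, critMap_image h1 h2 F hrad hin hsm] at hW
      subst hW
      by_cases hemp : WtSet F (fun k : Fin (i + 1) => A⁻¹ (Fin.castLE hin k)) = ∅
      · left; rw [hemp, Set.image_empty]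
      · right
        constructor
        · rw [wt_algebraic F hrad hsm]
          exact ⟨_, image_zLocus h1 h2 _⟩
        · rw [setDim_image h1 h2]
          apply le_antisymm
          · exact hc ⟨i, by omega⟩ A⁻¹ (hAc _)
          · exact wt_lower F hrad hequi hsm _ hi (by omega) (Set.nonempty_iff_ne_empty.mpr hemp)

end Final

/-- for a radical system defining a smooth equidimensional algebraic set
`V ⊆ ℂ^n` of dimension `d`, there is a nonempty Zariski open set of matrices `A` such
that `crit(φ_i, V^A)` is either empty or an algebraic set of dimension `i-1`. -/
theorem statement_2 (n s d : ℕ) (f : Fin s → MvPolynomial (Fin n) ℝ)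
    (V : Set (Fin n → ℂ))
    (hV : V = zLocus (Set.range fun i => MvPolynomial.map (algebraMap ℝ ℂ) (f i)))
    (hrad : (Ideal.span (Set.range fun i => MvPolynomial.map (algebraMap ℝ ℂ) (f i))).IsRadical)
    (hne : V.Nonempty)
    (hequi : EquidimIdeal (vIdeal V) d)
    (hsmooth : singLocus V d = ∅) :
    ∃ 𝒜 : Set (Matrix (Fin n) (Fin n) ℂ),
      IsZariskiOpenMat 𝒜 ∧ 𝒜.Nonempty ∧ (∀ A ∈ 𝒜, IsUnit A.det) ∧
      ∀ A ∈ 𝒜, ∀ i : ℕ, 1 ≤ i → i ≤ d + 1 →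
        ∀ W : Set (Fin n → ℂ), W = critProj ((fun v => A⁻¹.mulVec v) '' V) d i →
          W = ∅ ∨ ((∃ S : Set (MvPolynomial (Fin n) ℂ), W = zLocus S) ∧
            setDim W = ((i - 1 : ℕ) : WithBot (WithTop ℕ))) := by
  subst hV
  exact main_complex n s d _ hrad hne hequi hsmooth

end
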